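/- arXiv:1809.03986 — 4 statements merged into one kernel-verified Lean document; each statement's English description precedes it below -/
import Mathlib

section
/- There exists a universal constant c > 0 such that the following holds for every dimension d ≥ 1: if p : ℝ^d → ℝ is a polynomial of degree at most 4 with p(z) ≥ 0 for all z ∈ ℝ^d, μ ∈ ℝ^d, Σ is symmetric positive definite, and S ⊆ ℝ^d is measurable with N(μ,Σ;S) ≥ β for some β ∈ (0,1], then E_{z ∼ N(μ,Σ,S)}[p(z)] ≥ c · β⁴ · E_{z ∼ N(μ,Σ)}[p(z)]. -/
open MeasureTheory ProbabilityTheory Matrix Real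

noncomputable section

/-- Euclidean norm of a vector in `ℝ^d`. -/
def vnorm {d : ℕ} (x : Fin d → ℝ) : ℝ := Real.sqrt (∑ i, x i ^ 2)

/-- Frobenius norm of a `d × d` real matrix. -/
def fnorm {d : ℕ} (A : Matrix (Fin d) (Fin d) ℝ) : ℝ := Real.sqrt (∑ i, ∑ j, A i j ^ 2)

/-- Density of the `d`-variate normal distribution `N(μ, Σ)`. -/
def gpdf {d : ℕ} (μ : Fin d → ℝ) (Sg : Matrix (Fin d) (Fin d) ℝ) (x : Fin d → ℝ) : ℝ :=
  (Real.sqrt ((2 * Real.pi) ^ d * Sg.det))⁻¹ *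
    Real.exp (-(1 / 2) * ((x - μ) ⬝ᵥ (Sg⁻¹ *ᵥ (x - μ))))

/-- The `d`-variate normal distribution `N(μ, Σ)` as a measure on `ℝ^d`. -/
def gauss {d : ℕ} (μ : Fin d → ℝ) (Sg : Matrix (Fin d) (Fin d) ℝ) : Measure (Fin d → ℝ) :=
  volume.withDensity fun x => ENNReal.ofReal (gpdf μ Sg x)

/-- The `S`-truncated normal distribution `N(μ, Σ, S)`: the normal `N(μ, Σ)`
conditioned on taking values in `S`. -/
def truncGauss {d : ℕ} (μ : Fin d → ℝ) (Sg : Matrix (Fin d) (Fin d) ℝ)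
    (S : Set (Fin d → ℝ)) : Measure (Fin d → ℝ) :=
  ProbabilityTheory.cond (gauss μ Sg) S

/-- Mean vector of a measure on `ℝ^d`. -/
def meanv {d : ℕ} (P : Measure (Fin d → ℝ)) : Fin d → ℝ := fun i => ∫ x, x i ∂P

/-- Covariance matrix of a measure on `ℝ^d`. -/
def covm {d : ℕ} (P : Measure (Fin d → ℝ)) : Matrix (Fin d) (Fin d) ℝ :=
  Matrix.of fun i j => ∫ x, (x i - meanv P i) * (x j - meanv P j) ∂P

/-- Real trigonometric polynomials of degree at most `m`. -/
def Trig (m : ℕ) (f : ℝ → ℝ) : Prop :=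
  ∃ R : Polynomial ℂ, R.natDegree ≤ 2 * m ∧
    ∀ θ : ℝ, (f θ : ℂ) * Complex.exp (θ * Complex.I) ^ m = R.eval (Complex.exp (θ * Complex.I))

lemma Trig.const (m : ℕ) (c : ℝ) : Trig m (fun _ => c) := by
  refine ⟨Polynomial.C (c : ℂ) * Polynomial.X ^ m, ?_, fun θ => by simp⟩
  refine (Polynomial.natDegree_C_mul_X_pow_le _ _).trans (by omega)

lemma Trig.add {m : ℕ} {f g : ℝ → ℝ} (hf : Trig m f) (hg : Trig m g) :
    Trig m (fun θ => f θ + g θ) := by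
  obtain ⟨R, hR, h⟩ := hf
  obtain ⟨R', hR', h'⟩ := hg
  refine ⟨R + R', (Polynomial.natDegree_add_le _ _).trans (by simp [hR, hR']), fun θ => ?_⟩
  rw [Polynomial.eval_add, ← h, ← h']
  push_cast
  ring

lemma Trig.mul {m n : ℕ} {f g : ℝ → ℝ} (hf : Trig m f) (hg : Trig n g) :
    Trig (m + n) (fun θ => f θ * g θ) := by
  obtain ⟨R, hR, h⟩ := hf
  obtain ⟨R', hR', h'⟩ := hg
  refine ⟨R * R', (Polynomial.natDegree_mul_le).trans (by omega), fun θ => ?_⟩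
  rw [Polynomial.eval_mul, ← h, ← h']
  push_cast
  ring

lemma Trig.mono {m n : ℕ} {f : ℝ → ℝ} (hf : Trig m f) (h : m ≤ n) : Trig n f := by
  have := hf.mul (Trig.const (n - m) 1)
  simpa [Nat.add_sub_cancel' h] using this

lemma Trig.pow {m : ℕ} {f : ℝ → ℝ} (hf : Trig m f) (k : ℕ) :
    Trig (k * m) (fun θ => f θ ^ k) := by
  induction k with
  | zero => simpa using Trig.const 0 1
  | succ k ih =>
    have := ih.mul hf
    simpa [pow_succ, Nat.succ_mul] using this

lemma Trig.prod {ι : Type*} (s : Finset ι) (m : ι → ℕ) (f : ι → ℝ → ℝ)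
    (h : ∀ i, Trig (m i) (f i)) : Trig (∑ i ∈ s, m i) (fun θ => ∏ i ∈ s, f i θ) := by
  classical
  induction s using Finset.induction_on with
  | empty => simpa using Trig.const 0 1
  | insert a s ha ih =>
    simp only [Finset.sum_insert ha, Finset.prod_insert ha]
    exact (h a).mul ih

lemma Trig.sum {ι : Type*} (s : Finset ι) (m : ℕ) (f : ι → ℝ → ℝ)
    (h : ∀ i ∈ s, Trig m (f i)) : Trig m (fun θ => ∑ i ∈ s, f i θ) := by
  classical
  induction s using Finset.induction_on with
  | empty => simpa using Trig.const m 0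
  | insert a s ha ih =>
    simp only [Finset.sum_insert ha]
    exact (h a (by simp)).add (ih fun i hi => h i (by simp [hi]))

lemma Trig.cos_sin (a b : ℝ) : Trig 1 (fun θ => Real.cos θ * a + Real.sin θ * b) := by
  refine ⟨Polynomial.C ((a : ℂ) / 2) * (Polynomial.X ^ 2 + 1)
    + Polynomial.C (-(b : ℂ) * Complex.I / 2) * (Polynomial.X ^ 2 - 1), ?_, fun θ => ?_⟩
  · compute_degree
  · have h : Complex.exp (θ * Complex.I) = Complex.cos θ + Complex.sin θ * Complex.I :=
      Complex.exp_mul_I _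
    have h2 := Complex.sin_sq_add_cos_sq (θ : ℂ)
    have h3 := Complex.I_sq
    simp only [Polynomial.eval_add, Polynomial.eval_mul, Polynomial.eval_C, Polynomial.eval_pow,
      Polynomial.eval_X, Polynomial.eval_one, Polynomial.eval_sub, h]
    push_cast
    generalize Complex.cos θ = c at *
    generalize Complex.sin θ = s at *
    generalize Complex.I = i at *
    grind

lemma Trig.deriv {m : ℕ} {f f' : ℝ → ℝ} (hf : Trig m f) (h : ∀ θ, HasDerivAt f (f' θ) θ) :
    Trig m f' := by
  obtain ⟨R, hR, hr⟩ := hf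
  refine ⟨Polynomial.C Complex.I * (Polynomial.X * Polynomial.derivative R
    - Polynomial.C (m : ℂ) * R), ?_, fun θ => ?_⟩
  · refine (Polynomial.natDegree_C_mul_le _ _).trans
      ((Polynomial.natDegree_sub_le _ _).trans (max_le ?_ ?_))
    · by_cases h0 : R.natDegree = 0
      · rw [Polynomial.natDegree_eq_zero] at h0
        obtain ⟨c, rfl⟩ := h0
        simp
      · refine Polynomial.natDegree_mul_le.trans ?_
        have := Polynomial.natDegree_derivative_lt h0
        simp only [Polynomial.natDegree_X]
        omega
    · exact (Polynomial.natDegree_C_mul_le _ _).trans hR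
  · have he : HasDerivAt (fun x : ℝ => Complex.exp (x * Complex.I))
        (Complex.exp (θ * Complex.I) * Complex.I) θ := by
      have : HasDerivAt (fun x : ℝ => (x : ℂ) * Complex.I) (1 * Complex.I) θ :=
        (Complex.ofRealCLM.hasDerivAt (x := θ)).mul_const _
      simpa using this.cexp
    have h1 : HasDerivAt (fun x : ℝ => (f x : ℂ) * Complex.exp (x * Complex.I) ^ m) _ θ :=
      (h θ).ofReal_comp.mul (he.fun_pow m)
    have h2 : HasDerivAt (fun x : ℝ => R.eval (Complex.exp (x * Complex.I)))
        (R.derivative.eval (Complex.exp (θ * Complex.I)) * (Complex.exp (θ * Complex.I) * Complex.I))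
        θ := by
      have h4 := (R.hasDerivAt (Complex.exp (θ * Complex.I)))
      exact HasDerivAt.comp (h₂ := fun z => R.eval z) θ h4 he
    have h3 := h1.unique ((funext hr) ▸ h2)
    simp only [Polynomial.eval_mul, Polynomial.eval_C, Polynomial.eval_sub, Polynomial.eval_X]
    rw [← hr]
    rcases m with _ | m
    · simp at h3 ⊢
      rw [h3]; ring
    · simp only [Nat.add_sub_cancel] at h3
      linear_combination h3

lemma Trig.zeros {m : ℕ} {f : ℝ → ℝ} (hf : Trig m f) :
    (∀ θ, f θ = 0) ∨ ∃ Z : Finset ℝ, Z.card ≤ 2 * m ∧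
      ∀ θ ∈ Set.Ioo 0 (2 * π), f θ = 0 → θ ∈ Z := by
  obtain ⟨R, hR, hr⟩ := hf
  by_cases h0 : R = 0
  · left
    intro θ
    have := hr θ
    simpa [h0] using this
  · right
    have hinj : Set.InjOn (fun θ : ℝ => Complex.exp (θ * Complex.I)) (Set.Ioo 0 (2 * π)) := by
      intro x hx y hy hxy
      simp only at hxy
      rw [Complex.exp_eq_exp_iff_exists_int] at hxy
      obtain ⟨n, hn⟩ := hxy
      have h1 : (x : ℂ) = y + n * (2 * π) := by
        have := Complex.I_ne_zero
        apply mul_right_cancel₀ this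
        linear_combination hn
      have h2 : x = y + n * (2 * π) := by exact_mod_cast h1
      have h3 : (n : ℝ) < 1 := by
        by_contra! hc
        nlinarith [hx.1, hx.2, hy.1, hy.2, Real.pi_pos]
      have h4 : -1 < (n : ℝ) := by
        by_contra! hc
        nlinarith [hx.1, hx.2, hy.1, hy.2, Real.pi_pos]
      have h5 : n = 0 := by
        have : n < 1 := by exact_mod_cast h3
        have : -1 < n := by exact_mod_cast h4
        omega
      simpa [h5] using h2
    set A := {θ ∈ Set.Ioo 0 (2 * π) | f θ = 0} with hA
    have hmaps : Set.MapsTo (fun θ : ℝ => Complex.exp (θ * Complex.I)) A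
        (R.roots.toFinset : Set ℂ) := by
      intro θ hθ
      simp only [Finset.mem_coe, Multiset.mem_toFinset, Polynomial.mem_roots h0,
        Polynomial.IsRoot.def]
      rw [← hr, hθ.2]; simp
    have hfin : A.Finite := Set.Finite.of_injOn hmaps
      (hinj.mono (fun θ hθ => hθ.1)) (Finset.finite_toSet _)
    refine ⟨hfin.toFinset, ?_, fun θ h1 h2 => by simp [hA, h2]; exact h1⟩
    have := Finset.card_le_card_of_injOn (s := hfin.toFinset) (t := R.roots.toFinset)
      (fun θ : ℝ => Complex.exp (θ * Complex.I)) (by simpa using hmaps)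
      (by simpa using hinj.mono (fun θ hθ => hθ.1))
    exact this.trans ((Multiset.toFinset_card_le _).trans ((Polynomial.card_roots' _).trans hR))

lemma piece {f f' : ℝ → ℝ} (h : ∀ θ, HasDerivAt f (f' θ) θ) (hc : Continuous f')
    (t δ : ℝ) (a b : ℝ) (hne : ∀ θ ∈ Set.Ioo a b, f' θ ≠ 0) :
    ENNReal.ofReal δ * volume ({θ | |f θ| ≤ t ∧ δ ≤ |f' θ|} ∩ Set.Ioo a b)
      ≤ ENNReal.ofReal (2 * t) := by
  have hcf : Continuous f := continuous_iff_continuousAt.2 fun θ => (h θ).continuousAt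
  set A := {θ | |f θ| ≤ t ∧ δ ≤ |f' θ|} ∩ Set.Ioo a b with hA
  have hAm : MeasurableSet A :=
    (IsClosed.measurableSet ((isClosed_le hcf.abs continuous_const).inter
      (isClosed_le continuous_const hc.abs))).inter measurableSet_Ioo
  have key : ∀ x ∈ Set.Ioo a b, ∀ y ∈ Set.Ioo a b, x < y → f x ≠ f y := by
    intro x hx y hy hxy he
    obtain ⟨c, hc1, hc2⟩ := exists_hasDerivAt_eq_zero hxy hcf.continuousOn he (fun z _ => h z)
    exact hne c ⟨hx.1.trans hc1.1, hc1.2.trans hy.2⟩ hc2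
  have hinj : Set.InjOn f A := by
    intro x hx y hy he
    rcases lt_trichotomy x y with hl | hl | hl
    · exact absurd he (key x hx.2 y hy.2 hl)
    · exact hl
    · exact absurd he.symm (key y hy.2 x hx.2 hl)
  have h1 := lintegral_image_eq_lintegral_abs_deriv_mul hAm
    (fun x _ => (h x).hasDerivWithinAt) hinj (fun _ => 1)
  calc ENNReal.ofReal δ * volume A = ∫⁻ x in A, ENNReal.ofReal δ := by simp
    _ ≤ ∫⁻ x in A, ENNReal.ofReal |f' x| * 1 := by
        refine setLIntegral_mono_ae (by fun_prop) (ae_of_all _ fun x hx => ?_)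
        rw [mul_one]
        exact ENNReal.ofReal_le_ofReal hx.1.2
    _ = volume (f '' A) := by rw [← h1]; simp
    _ ≤ volume (Set.Icc (-t) t) := by
        refine measure_mono ?_
        rintro _ ⟨x, hx, rfl⟩
        exact abs_le.1 hx.1.1
    _ = ENNReal.ofReal (2 * t) := by rw [Real.volume_Icc]; ring_nf

lemma pieces {f f' : ℝ → ℝ} (h : ∀ θ, HasDerivAt f (f' θ) θ) (hc : Continuous f')
    (t δ : ℝ) (Z : Finset ℝ) : ∀ (a b : ℝ) (_ : ∀ θ ∈ Set.Ioo a b, f' θ = 0 → θ ∈ Z),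
    ENNReal.ofReal δ * volume ({θ | |f θ| ≤ t ∧ δ ≤ |f' θ|} ∩ Set.Ioo a b)
      ≤ 2 ^ Z.card * ENNReal.ofReal (2 * t) := by
  induction Z using Finset.induction_on with
  | empty =>
    intro a b hz
    simpa using piece h hc t δ a b (fun θ hθ h0 => by simpa using hz θ hθ h0)
  | insert z Z hzZ ih =>
    intro a b hz
    rw [Finset.card_insert_of_notMem hzZ, pow_succ, mul_two, add_mul]
    by_cases hm : z ∈ Set.Ioo a b
    · have i1 := ih a z (fun θ hθ h0 => by
        have := hz θ ⟨hθ.1, hθ.2.trans hm.2⟩ h0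
        rcases Finset.mem_insert.1 this with r | r
        · exact absurd r hθ.2.ne
        · exact r)
      have i2 := ih z b (fun θ hθ h0 => by
        have := hz θ ⟨hm.1.trans hθ.1, hθ.2⟩ h0
        rcases Finset.mem_insert.1 this with r | r
        · exact absurd r hθ.1.ne'
        · exact r)
      refine le_trans ?_ (add_le_add i1 i2)
      rw [← mul_add]
      gcongr
      set A := {θ | |f θ| ≤ t ∧ δ ≤ |f' θ|}
      calc volume (A ∩ Set.Ioo a b)
          ≤ volume ({z} ∪ ((A ∩ Set.Ioo a z) ∪ (A ∩ Set.Ioo z b))) := by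
            refine measure_mono ?_
            rintro x ⟨hx, hx1, hx2⟩
            rcases lt_trichotomy x z with hl | hl | hl
            · exact Or.inr (Or.inl ⟨hx, hx1, hl⟩)
            · exact Or.inl hl
            · exact Or.inr (Or.inr ⟨hx, hl, hx2⟩)
        _ ≤ volume {z} + (volume (A ∩ Set.Ioo a z) + volume (A ∩ Set.Ioo z b)) :=
            (measure_union_le _ _).trans (add_le_add le_rfl (measure_union_le _ _))
        _ = _ := by simp
    · refine (ih a b (fun θ hθ h0 => ?_)).trans le_self_add
      rcases Finset.mem_insert.1 (hz θ hθ h0) with r | r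
      · exact absurd (r ▸ hθ) hm
      · exact r

lemma Trig.level {m : ℕ} {f f' : ℝ → ℝ} (hf : Trig m f) (h : ∀ θ, HasDerivAt f (f' θ) θ)
    (hc : Continuous f') (t δ : ℝ) (hδ : 0 < δ) :
    ENNReal.ofReal δ * volume ({θ | |f θ| ≤ t ∧ δ ≤ |f' θ|} ∩ Set.Ioo 0 (2 * π))
      ≤ 2 ^ (2 * m) * ENNReal.ofReal (2 * t) := by
  rcases (hf.deriv h).zeros with h0 | ⟨Z, hZ, hz⟩
  · have : {θ | |f θ| ≤ t ∧ δ ≤ |f' θ|} ∩ Set.Ioo 0 (2 * π) = ∅ := by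
      ext θ
      simp [h0, hδ]
    simp [this]
  · refine (pieces h hc t δ Z 0 (2 * π) hz).trans ?_
    gcongr
    norm_num

/-- Directional derivative of `p` at `x` in direction `y`. -/
def dirD {d : ℕ} (p : MvPolynomial (Fin d) ℝ) (x y : Fin d → ℝ) : ℝ :=
  ∑ i, y i * MvPolynomial.eval x (MvPolynomial.pderiv i p)

/-- Directional derivative as a polynomial. -/
def dirP {d : ℕ} (p : MvPolynomial (Fin d) ℝ) (y : Fin d → ℝ) : MvPolynomial (Fin d) ℝ :=
  ∑ i, MvPolynomial.C (y i) * MvPolynomial.pderiv i p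

lemma eval_dirP {d : ℕ} (p : MvPolynomial (Fin d) ℝ) (x y : Fin d → ℝ) :
    MvPolynomial.eval x (dirP p y) = dirD p x y := by
  simp [dirP, dirD]

lemma totalDegree_pderiv_le' {d m : ℕ} (p : MvPolynomial (Fin d) ℝ) (h : p.totalDegree ≤ m + 1)
    (i : Fin d) : (MvPolynomial.pderiv i p).totalDegree ≤ m := by
  rw [MvPolynomial.as_sum p, map_sum]
  refine MvPolynomial.totalDegree_finsetSum_le fun s hs => ?_
  rw [MvPolynomial.pderiv_monomial]
  by_cases h0 : s i = 0
  · simp [h0]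
  · refine (MvPolynomial.totalDegree_monomial_le _ _).trans ?_
    have h1 := (MvPolynomial.le_totalDegree hs).trans h
    have h2 : (s - Finsupp.single i 1) + Finsupp.single i 1 = s := by
      apply tsub_add_cancel_of_le
      simp only [Finsupp.single_le_iff]
      omega
    rw [← h2, Finsupp.sum_add_index' (by simp) (by simp)] at h1
    simp at h1
    exact h1

lemma totalDegree_dirP {d m : ℕ} (p : MvPolynomial (Fin d) ℝ) (h : p.totalDegree ≤ m + 1)
    (y : Fin d → ℝ) : (dirP p y).totalDegree ≤ m := by
  refine MvPolynomial.totalDegree_finsetSum_le fun i _ => ?_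
  refine (MvPolynomial.totalDegree_mul _ _).trans ?_
  simpa using totalDegree_pderiv_le' p h i

lemma hasDerivAt_eval {d : ℕ} (p : MvPolynomial (Fin d) ℝ) (c c' : ℝ → Fin d → ℝ) (θ : ℝ)
    (h : ∀ i, HasDerivAt (fun s => c s i) (c' θ i) θ) :
    HasDerivAt (fun s => MvPolynomial.eval (c s) p) (dirD p (c θ) (c' θ)) θ := by
  induction p using MvPolynomial.induction_on with
  | C a => simpa [dirD] using hasDerivAt_const θ a
  | add p q hp hq =>
    have e : (fun s => MvPolynomial.eval (c s) (p + q)) =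
        (fun s => MvPolynomial.eval (c s) p) + fun s => MvPolynomial.eval (c s) q := by
      funext s
      simp
    rw [e]
    refine (hp.add hq).congr_deriv (Eq.symm ?_)
    simp [dirD, mul_add, Finset.sum_add_distrib]
  | mul_X p i hp =>
    have e : (fun s => MvPolynomial.eval (c s) (p * MvPolynomial.X i)) =
        (fun s => MvPolynomial.eval (c s) p) * fun s => c s i := by
      funext s
      simp
    rw [e]
    refine (hp.mul (h i)).congr_deriv (Eq.symm ?_)
    simp only [dirD, Derivation.leibniz, MvPolynomial.pderiv_X, smul_eq_mul, map_add, map_mul,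
      MvPolynomial.eval_X, mul_add, Finset.sum_add_distrib, Finset.sum_mul]
    rw [add_comm]
    congr 1
    · exact Finset.sum_congr rfl fun j _ => by ring
    · rw [Finset.sum_eq_single i]
      · simp; ring
      · intro j _ hj
        simp [Pi.single_apply, hj.symm]
      · simp

/-- The point at angle `θ` on the ellipse through `x`, `y`. -/
def rotX {d : ℕ} (x y : Fin d → ℝ) (θ : ℝ) : Fin d → ℝ := Real.cos θ • x + Real.sin θ • y

/-- The tangent at angle `θ` of the ellipse through `x`, `y`. -/
def rotY {d : ℕ} (x y : Fin d → ℝ) (θ : ℝ) : Fin d → ℝ := -Real.sin θ • x + Real.cos θ • y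

lemma hasDerivAt_rot {d : ℕ} (p : MvPolynomial (Fin d) ℝ) (x y : Fin d → ℝ) (θ : ℝ) :
    HasDerivAt (fun s => MvPolynomial.eval (rotX x y s) p) (dirD p (rotX x y θ) (rotY x y θ)) θ := by
  refine hasDerivAt_eval p (rotX x y) (rotY x y) θ fun i => ?_
  simp only [rotX, rotY, Pi.add_apply, Pi.smul_apply, smul_eq_mul]
  exact ((Real.hasDerivAt_cos θ).mul_const _).add ((Real.hasDerivAt_sin θ).mul_const _)

lemma trig_rot {d m : ℕ} (p : MvPolynomial (Fin d) ℝ) (h : p.totalDegree ≤ m)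
    (x y : Fin d → ℝ) : Trig m (fun s => MvPolynomial.eval (rotX x y s) p) := by
  simp_rw [MvPolynomial.eval_eq']
  refine Trig.sum _ _ _ fun s hs => ?_
  have h1 := (MvPolynomial.le_totalDegree hs).trans h
  have h2 : Trig (∑ i, s i * 1) (fun θ => ∏ i, (rotX x y θ i) ^ s i) :=
    Trig.prod _ _ _ fun i => (Trig.cos_sin (x i) (y i)).pow (s i)
  have h3 := (Trig.const 0 (p.coeff s)).mul h2
  refine h3.mono ?_
  rw [Finsupp.sum_fintype _ _ (by simp)] at h1
  simpa using h1

/-- Polynomial growth. -/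
def Gr {E : Type*} [NormedAddCommGroup E] (f : E → ℝ) : Prop :=
  ∃ C : ℝ, 0 ≤ C ∧ ∃ k : ℕ, ∀ x, |f x| ≤ C * (1 + ‖x‖) ^ k

lemma Gr.const {E : Type*} [NormedAddCommGroup E] (c : ℝ) : Gr (fun _ : E => c) :=
  ⟨|c|, abs_nonneg _, 0, fun x => by simp⟩

lemma Gr.add {E : Type*} [NormedAddCommGroup E] {f g : E → ℝ} (hf : Gr f) (hg : Gr g) :
    Gr (fun x => f x + g x) := by
  obtain ⟨C, hC, k, h⟩ := hf
  obtain ⟨C', hC', k', h'⟩ := hg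
  refine ⟨C + C', by positivity, k + k', fun x => (abs_add_le _ _).trans ?_⟩
  have h1 : (1 : ℝ) ≤ 1 + ‖x‖ := by linarith [norm_nonneg x]
  rw [add_mul]
  refine add_le_add ((h x).trans ?_) ((h' x).trans ?_)
  · gcongr
    omega
  · gcongr
    omega

lemma Gr.mul {E : Type*} [NormedAddCommGroup E] {f g : E → ℝ} (hf : Gr f) (hg : Gr g) :
    Gr (fun x => f x * g x) := by
  obtain ⟨C, hC, k, h⟩ := hf
  obtain ⟨C', hC', k', h'⟩ := hg
  refine ⟨C * C', by positivity, k + k', fun x => ?_⟩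
  rw [abs_mul, pow_add]
  calc |f x| * |g x| ≤ (C * (1 + ‖x‖) ^ k) * (C' * (1 + ‖x‖) ^ k') := by
        gcongr
        · exact h x
        · exact h' x
    _ = _ := by ring

lemma Gr.sum {E : Type*} [NormedAddCommGroup E] {ι : Type*} (s : Finset ι) (f : ι → E → ℝ)
    (h : ∀ i, Gr (f i)) : Gr (fun x => ∑ i ∈ s, f i x) := by
  classical
  induction s using Finset.induction_on with
  | empty => simpa using Gr.const 0
  | insert a s ha ih =>
    simp only [Finset.sum_insert ha]
    exact (h a).add ih

lemma Gr.eval {E : Type*} [NormedAddCommGroup E] {d : ℕ} (p : MvPolynomial (Fin d) ℝ)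
    (g : E → Fin d → ℝ) (hg : ∀ x, ‖g x‖ ≤ ‖x‖) : Gr (fun x => MvPolynomial.eval (g x) p) := by
  induction p using MvPolynomial.induction_on with
  | C a => simpa using Gr.const a
  | add p q hp hq => simpa using hp.add hq
  | mul_X p i hp =>
    simp only [map_mul, MvPolynomial.eval_X]
    refine hp.mul ⟨1, zero_le_one, 1, fun x => ?_⟩
    have := (norm_le_pi_norm (g x) i).trans (hg x)
    rw [Real.norm_eq_abs] at this
    linarith

lemma Gr.dirD {d : ℕ} (p : MvPolynomial (Fin d) ℝ) :
    Gr (fun z : (Fin d → ℝ) × (Fin d → ℝ) => dirD p z.1 z.2) := by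
  refine Gr.sum _ _ fun i => ?_
  refine Gr.mul ⟨1, zero_le_one, 1, fun x => ?_⟩ (Gr.eval _ _ fun x => norm_fst_le x)
  have := (norm_le_pi_norm x.2 i).trans (norm_snd_le x)
  rw [Real.norm_eq_abs] at this
  linarith

lemma Gr.integrable {E : Type*} [NormedAddCommGroup E] [NormedSpace ℝ E] [CompleteSpace E]
    [SecondCountableTopology E] [MeasurableSpace E] [BorelSpace E] (γ : Measure E) [IsGaussian γ]
    {f : E → ℝ} (hf : Gr f) (hc : Continuous f) : Integrable f γ := by
  obtain ⟨C, hC, k, h⟩ := hf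
  have h1 : Integrable (fun x : E => (1 + ‖x‖) ^ k) γ := by
    have h3 : MemLp (fun x : E => ‖x‖) k γ := (IsGaussian.memLp_id γ k (by simp)).norm
    have h4 : MemLp (fun x : E => (1 : ℝ)) k γ := memLp_const 1
    have h2 : MemLp (fun x : E => 1 + ‖x‖) k γ := h4.add h3
    have := h2.integrable_norm_pow'
    refine this.congr (ae_of_all _ fun x => ?_)
    simp only
    rw [Real.norm_of_nonneg (by positivity)]
  refine (h1.const_mul C).mono' hc.aestronglyMeasurable (ae_of_all _ fun x => ?_)
  rw [Real.norm_eq_abs]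
  exact h x

lemma continuous_dirD {d : ℕ} (p : MvPolynomial (Fin d) ℝ) :
    Continuous (fun z : (Fin d → ℝ) × (Fin d → ℝ) => dirD p z.1 z.2) := by
  unfold dirD
  refine continuous_finsetSum _ fun i _ => ?_
  exact ((continuous_apply i).comp continuous_snd).mul
    ((MvPolynomial.continuous_eval _).comp continuous_fst)

lemma exists_affine_comp {d : ℕ} (p : MvPolynomial (Fin d) ℝ) (m : ℕ) (h : p.totalDegree ≤ m)
    (v : Fin d → ℝ) (A : Matrix (Fin d) (Fin d) ℝ) :
    ∃ p' : MvPolynomial (Fin d) ℝ, p'.totalDegree ≤ m ∧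
      ∀ z, MvPolynomial.eval z p' = MvPolynomial.eval (v + A *ᵥ z) p := by
  let l : Fin d → MvPolynomial (Fin d) ℝ := fun i =>
    MvPolynomial.C (v i) + ∑ j, MvPolynomial.C (A i j) * MvPolynomial.X j
  have hl : ∀ i, (l i).totalDegree ≤ 1 := by
    intro i
    refine (MvPolynomial.totalDegree_add _ _).trans (max_le (by simp) ?_)
    refine MvPolynomial.totalDegree_finsetSum_le fun j _ => ?_
    refine (MvPolynomial.totalDegree_mul _ _).trans ?_
    simp
  have he : ∀ z i, MvPolynomial.eval z (l i) = (v + A *ᵥ z) i := by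
    intro z i
    simp [l, Matrix.mulVec, dotProduct]
  refine ⟨∑ s ∈ p.support, MvPolynomial.C (p.coeff s) * ∏ i, l i ^ s i, ?_, fun z => ?_⟩
  · refine MvPolynomial.totalDegree_finsetSum_le fun s hs => ?_
    refine (MvPolynomial.totalDegree_mul _ _).trans ?_
    have h1 := (MvPolynomial.le_totalDegree hs).trans h
    rw [Finsupp.sum_fintype _ _ (by simp)] at h1
    simp only [MvPolynomial.totalDegree_C, zero_add]
    refine (MvPolynomial.totalDegree_finsetProd _ _).trans (le_trans ?_ h1)
    refine Finset.sum_le_sum fun i _ => ?_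
    refine (MvPolynomial.totalDegree_pow _ _).trans ?_
    have := hl i
    nlinarith
  · rw [MvPolynomial.eval_eq' (v + A *ᵥ z) p]
    simp only [map_sum, map_mul, MvPolynomial.eval_C, map_prod, map_pow, he]

/-- Standard deviation of the directional derivative at `x` in a random direction. -/
def sg {d : ℕ} (γ : Measure (Fin d → ℝ)) (p : MvPolynomial (Fin d) ℝ) (x : Fin d → ℝ) : ℝ :=
  Real.sqrt (∫ y, (dirD p x y) ^ 2 ∂γ)

lemma continuous_dirD_right {d : ℕ} (p : MvPolynomial (Fin d) ℝ) (x : Fin d → ℝ) :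
    Continuous (fun y => dirD p x y) :=
  (continuous_dirD p).comp (Continuous.prodMk_right x)

lemma exists_clm_dirD {d : ℕ} (p : MvPolynomial (Fin d) ℝ) (x : Fin d → ℝ) :
    ∃ L : (Fin d → ℝ) →L[ℝ] ℝ, ∀ y, L y = dirD p x y := by
  refine ⟨∑ i, MvPolynomial.eval x (MvPolynomial.pderiv i p) •
    (ContinuousLinearMap.proj i : (Fin d → ℝ) →L[ℝ] ℝ), fun y => ?_⟩
  simp only [_root_.sum_apply, _root_.smul_apply,
    ContinuousLinearMap.proj_apply, smul_eq_mul, dirD]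
  exact Finset.sum_congr rfl fun i _ => mul_comm _ _

lemma law_dirD {d : ℕ} (γ : Measure (Fin d → ℝ)) [IsGaussian γ] (hγ : ∫ x, x ∂γ = 0)
    (p : MvPolynomial (Fin d) ℝ) (x : Fin d → ℝ) :
    γ.map (fun y => dirD p x y) = (gaussianReal 0 1).map (fun u => sg γ p x * u) := by
  obtain ⟨L, hL⟩ := exists_clm_dirD p x
  have e : (fun y => dirD p x y) = ⇑L := funext fun y => (hL y).symm
  have h0 : γ[L] = 0 := by rw [IsGaussian.integral_dual, hγ, map_zero]
  have hv : Var[L; γ] = (sg γ p x) ^ 2 := by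
    rw [variance_of_integral_eq_zero L.continuous.aemeasurable h0, sg, Real.sq_sqrt]
    · simp [hL]
    · exact integral_nonneg fun y => sq_nonneg _
  rw [e, IsGaussian.map_eq_gaussianReal L, h0, gaussianReal_map_const_mul, hv]
  simp only [mul_zero, mul_one]
  congr 1
  ext
  simp [sq_nonneg]

lemma memLp_dirD {d : ℕ} (γ : Measure (Fin d → ℝ)) [IsGaussian γ]
    (p : MvPolynomial (Fin d) ℝ) (x : Fin d → ℝ) : MemLp (fun y => dirD p x y) 2 γ := by
  obtain ⟨L, hL⟩ := exists_clm_dirD p x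
  have e : (fun y => dirD p x y) = ⇑L := funext fun y => (hL y).symm
  rw [e]
  exact IsGaussian.memLp_dual γ L 2 (by simp)

lemma integral_abs_dirD_le {d : ℕ} (γ : Measure (Fin d → ℝ)) [IsGaussian γ]
    (p : MvPolynomial (Fin d) ℝ) (x : Fin d → ℝ) : ∫ y, |dirD p x y| ∂γ ≤ sg γ p x := by
  have h := memLp_dirD γ p x
  have h1 := variance_nonneg (fun y => |dirD p x y|) γ
  have h' : MemLp (fun y => |dirD p x y|) 2 γ := h.abs
  rw [variance_eq_sub h'] at h1
  refine Real.le_sqrt_of_sq_le ?_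
  simpa using h1

lemma gauss_facts : ∃ c K : ℝ, 0 < c ∧ 0 < K ∧
    ∀ (d : ℕ) (γ : Measure (Fin d → ℝ)) [IsGaussian γ] (_ : ∫ x, x ∂γ = 0)
      (p : MvPolynomial (Fin d) ℝ) (x : Fin d → ℝ),
      c ≤ γ.real {y | sg γ p x ≤ |dirD p x y|} ∧
      γ.real {y | K * sg γ p x < |dirD p x y|} ≤ c / 4 := by
  set g := gaussianReal 0 1
  set c := g.real {u : ℝ | 1 ≤ |u|} with hc
  have hc0 : 0 < c := by
    have h1 : g (Set.Ioi 1) ≠ 0 := by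
      intro h
      have h2 := (gaussianReal_absolutelyContinuous' 0 (v := 1) (by simp)) h
      simp at h2
    have h3 : g {u : ℝ | 1 ≤ |u|} ≠ 0 := by
      intro h
      refine h1 (measure_mono_null (fun u hu => ?_) h)
      exact (le_of_lt hu).trans (le_abs_self u)
    exact ENNReal.toReal_pos h3 (measure_ne_top _ _)
  obtain ⟨K, hK0, hK⟩ : ∃ K : ℝ, 0 < K ∧ g.real {u : ℝ | K < |u|} ≤ c / 4 := by
    refine ⟨2 / Real.sqrt c, by positivity, ?_⟩
    have h1 := meas_ge_le_variance_div_sq (μ := g) (X := id) (memLp_id_gaussianReal 2)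
      (c := 2 / Real.sqrt c) (by positivity)
    have h2 : g {u : ℝ | 2 / Real.sqrt c < |u|} ≤ ENNReal.ofReal (c / 4) := by
      refine (measure_mono ?_).trans (h1.trans (le_of_eq ?_))
      · intro u hu
        simpa [g] using le_of_lt hu
      · congr 1
        simp [g, div_pow, Real.sq_sqrt hc0.le]
        norm_num
    exact ENNReal.toReal_le_of_le_ofReal (by positivity) h2
  refine ⟨c, K, hc0, hK0, fun d γ _ hγ p x => ?_⟩
  have hs : 0 ≤ sg γ p x := Real.sqrt_nonneg _
  have hm : ∀ A : Set ℝ, MeasurableSet A →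
      γ.real {y | dirD p x y ∈ A} = g.real {u | sg γ p x * u ∈ A} := by
    intro A hA
    have h1 : (γ.map (fun y => dirD p x y)).real A =
        ((gaussianReal 0 1).map (fun u => sg γ p x * u)).real A := by
      rw [law_dirD γ hγ p x]
    rw [map_measureReal_apply (continuous_dirD_right p x).measurable hA,
      map_measureReal_apply (by fun_prop) hA] at h1
    exact h1
  constructor
  · have h1 := hm {u | sg γ p x ≤ |u|} (measurableSet_le (by fun_prop) (by fun_prop))
    simp only [Set.mem_ofPred_eq] at h1
    rw [h1]
    refine measureReal_mono (fun u hu => ?_)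
    have hu' : 1 ≤ |u| := hu
    simp only [Set.mem_ofPred_eq, abs_mul, abs_of_nonneg hs]
    nlinarith
  · have h1 := hm {u | K * sg γ p x < |u|} (measurableSet_lt (by fun_prop) (by fun_prop))
    simp only [Set.mem_ofPred_eq] at h1
    rw [h1]
    refine (measureReal_mono (fun u hu => ?_)).trans hK
    simp only [Set.mem_ofPred_eq, abs_mul, abs_of_nonneg hs] at hu ⊢
    by_contra! hle
    nlinarith

lemma measurable_sg {d : ℕ} (γ : Measure (Fin d → ℝ)) [IsGaussian γ]
    (p : MvPolynomial (Fin d) ℝ) : Measurable (sg γ p) := by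
  have : StronglyMeasurable (fun x => ∫ y, (dirD p x y) ^ 2 ∂γ) :=
    StronglyMeasurable.integral_prod_right
      (f := fun x y => (dirD p x y) ^ 2) ((continuous_dirD p).pow 2).stronglyMeasurable
  exact this.measurable.sqrt

lemma integrable_sg {d : ℕ} (γ : Measure (Fin d → ℝ)) [IsGaussian γ]
    (p : MvPolynomial (Fin d) ℝ) : Integrable (sg γ p) γ := by
  have h1 : Integrable (fun z : (Fin d → ℝ) × (Fin d → ℝ) => (dirD p z.1 z.2) ^ 2)
      (γ.prod γ) := by
    simp_rw [pow_two]
    exact ((Gr.dirD p).mul (Gr.dirD p)).integrable _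
      ((continuous_dirD p).mul (continuous_dirD p))
  have h2 := h1.integral_prod_left
  refine ((integrable_const (1 : ℝ)).add h2).mono' (measurable_sg γ p).aestronglyMeasurable
    (ae_of_all _ fun x => ?_)
  have h3 : 0 ≤ ∫ y, (dirD p x y) ^ 2 ∂γ := integral_nonneg fun y => sq_nonneg _
  simp only [Pi.add_apply, sg, Real.norm_eq_abs, abs_of_nonneg (Real.sqrt_nonneg _)]
  nlinarith [Real.sq_sqrt h3, sq_nonneg (Real.sqrt (∫ y, (dirD p x y) ^ 2 ∂γ) - 1)]

lemma integrable_eval {d : ℕ} (γ : Measure (Fin d → ℝ)) [IsGaussian γ]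
    (p : MvPolynomial (Fin d) ℝ) : Integrable (fun x => MvPolynomial.eval x p) γ :=
  (Gr.eval p id fun x => le_rfl).integrable γ (MvPolynomial.continuous_eval p)

lemma integrable_dirD {d : ℕ} (γ : Measure (Fin d → ℝ)) [IsGaussian γ]
    (p : MvPolynomial (Fin d) ℝ) :
    Integrable (fun z : (Fin d → ℝ) × (Fin d → ℝ) => dirD p z.1 z.2) (γ.prod γ) :=
  (Gr.dirD p).integrable _ (continuous_dirD p)

lemma sg_nonneg {d : ℕ} (γ : Measure (Fin d → ℝ)) (p : MvPolynomial (Fin d) ℝ)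
    (x : Fin d → ℝ) : 0 ≤ sg γ p x := Real.sqrt_nonneg _

lemma part2 {d m : ℕ} {c K C : ℝ} (hc : 0 < c) (hK : 0 < K) (γ : Measure (Fin d → ℝ))
    [IsGaussian γ] (p : MvPolynomial (Fin d) ℝ) (hp : p.totalDegree ≤ m + 1)
    (hg : ∀ x, c ≤ γ.real {y | sg γ p x ≤ |dirD p x y|} ∧
      γ.real {y | K * sg γ p x < |dirD p x y|} ≤ c / 4)
    (IH : ∀ q : MvPolynomial (Fin d) ℝ, q.totalDegree ≤ m → ∀ t : ℝ, 0 ≤ t →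
      0 < γ.real {x | |MvPolynomial.eval x q| ≤ t} →
      γ.real {x | |MvPolynomial.eval x q| ≤ t} ^ m * ∫ x, |MvPolynomial.eval x q| ∂γ ≤ C * t)
    (δ : ℝ) (hδ : 0 ≤ δ) (hw : 0 < ∫ x, sg γ p x ∂γ) (hs : 0 < γ.real {x | sg γ p x ≤ δ}) :
    (γ.real {x | sg γ p x ≤ δ} / 2) ^ m * (c * (∫ x, sg γ p x ∂γ) / 2) ≤ C * (K * δ) := by
  set s := γ.real {x | sg γ p x ≤ δ} with hsdef
  set w := ∫ x, sg γ p x ∂γ with hwdef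
  have hσ := measurable_sg γ p
  have hσi := integrable_sg γ p
  have hD : Measurable (fun z : (Fin d → ℝ) × (Fin d → ℝ) => |dirD p z.1 z.2|) :=
    (continuous_dirD p).abs.measurable
  have hσ1 : Measurable (fun z : (Fin d → ℝ) × (Fin d → ℝ) => sg γ p z.1) :=
    hσ.comp measurable_fst
  have hS : MeasurableSet {x | sg γ p x ≤ δ} := measurableSet_le hσ measurable_const
  set A1 : Set ((Fin d → ℝ) × (Fin d → ℝ)) := {z | sg γ p z.1 ≤ |dirD p z.1 z.2|} with hA1
  set A2 : Set ((Fin d → ℝ) × (Fin d → ℝ)) :=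
    {z | sg γ p z.1 ≤ δ ∧ K * δ < |dirD p z.1 z.2|} with hA2
  have mA1 : MeasurableSet A1 := measurableSet_le hσ1 hD
  have mA2 : MeasurableSet A2 :=
    (measurableSet_le hσ1 measurable_const).inter (measurableSet_lt measurable_const hD)
  set f1 : (Fin d → ℝ) × (Fin d → ℝ) → ℝ := A1.indicator (fun z => sg γ p z.1) with hf1
  set f2 : (Fin d → ℝ) × (Fin d → ℝ) → ℝ := A2.indicator (fun _ => (1 : ℝ)) with hf2
  have i1 : Integrable f1 (γ.prod γ) := (hσi.comp_fst γ).indicator mA1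
  have i2 : Integrable f2 (γ.prod γ) := (integrable_const 1).indicator mA2
  have I1 : c * w ≤ ∫ z, f1 z ∂(γ.prod γ) := by
    rw [integral_prod _ i1, hwdef, ← integral_const_mul]
    refine integral_mono (hσi.const_mul c) i1.integral_prod_left fun x => ?_
    have e : (fun y => f1 (x, y)) =
        {y | sg γ p x ≤ |dirD p x y|}.indicator (fun _ => sg γ p x) := by
      funext y
      simp [f1, A1, Set.indicator]
    have mx : MeasurableSet {y | sg γ p x ≤ |dirD p x y|} :=
      measurableSet_le measurable_const (continuous_dirD_right p x).abs.measurable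
    simp only [e]
    rw [integral_indicator_const _ mx, smul_eq_mul]
    exact mul_le_mul_of_nonneg_right (hg x).1 (sg_nonneg γ p x)
  have I2 : ∫ z, f2 z ∂(γ.prod γ) ≤ (c / 4) * s := by
    have e0 : (c / 4) * s = ∫ x, {x | sg γ p x ≤ δ}.indicator (fun _ => c / 4) x ∂γ := by
      rw [integral_indicator_const _ hS, smul_eq_mul, mul_comm]
    rw [integral_prod _ i2, e0]
    refine integral_mono i2.integral_prod_left ((integrable_const _).indicator hS) fun x => ?_
    by_cases hx : sg γ p x ≤ δ
    · have e : (fun y => f2 (x, y)) =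
          {y | K * δ < |dirD p x y|}.indicator (fun _ => (1 : ℝ)) := by
        funext y
        simp [f2, A2, Set.indicator, hx]
      have mx : MeasurableSet {y | K * δ < |dirD p x y|} :=
        measurableSet_lt measurable_const (continuous_dirD_right p x).abs.measurable
      simp only [e]
      rw [integral_indicator_const _ mx, smul_eq_mul, mul_one,
        Set.indicator_of_mem (show x ∈ {x | sg γ p x ≤ δ} from hx)]
      refine (measureReal_mono (fun y hy => ?_)).trans (hg x).2
      have hy' : K * δ < |dirD p x y| := hy
      exact lt_of_le_of_lt (mul_le_mul_of_nonneg_left hx hK.le) hy'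
    · have e : (fun y => f2 (x, y)) = fun _ => 0 := by
        funext y
        simp [f2, A2, Set.indicator, hx]
      simp only [e]
      simp [Set.indicator, hx]
  have iG : Integrable (fun z => s * f1 z - 2 * w * f2 z) (γ.prod γ) :=
    (i1.const_mul s).sub (i2.const_mul _)
  have iGs : s * w * c / 2 ≤ ∫ z, (s * f1 z - 2 * w * f2 z) ∂(γ.prod γ) := by
    rw [integral_sub (i1.const_mul s) (i2.const_mul _), integral_const_mul, integral_const_mul]
    nlinarith [mul_le_mul_of_nonneg_left I1 hs.le, mul_le_mul_of_nonneg_left I2 hw.le]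
  rw [integral_prod_symm _ iG] at iGs
  obtain ⟨y, hy⟩ := exists_integral_le iG.integral_prod_right
  have hy := iGs.trans hy
  have hDy : Measurable (fun x => |dirD p x y|) :=
    ((continuous_dirD p).comp (Continuous.prodMk_left y)).abs.measurable
  have mx1 : MeasurableSet {x | sg γ p x ≤ |dirD p x y|} :=
    measurableSet_le hσ hDy
  have mx2 : MeasurableSet {x | sg γ p x ≤ δ ∧ K * δ < |dirD p x y|} :=
    (measurableSet_le hσ measurable_const).inter (measurableSet_lt measurable_const hDy)
  have e1 : (fun x => f1 (x, y)) = {x | sg γ p x ≤ |dirD p x y|}.indicator (sg γ p) := by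
    funext x
    simp [f1, A1, Set.indicator]
  have e2 : (fun x => f2 (x, y)) =
      {x | sg γ p x ≤ δ ∧ K * δ < |dirD p x y|}.indicator (fun _ => (1 : ℝ)) := by
    funext x
    simp [f2, A2, Set.indicator]
  have j1 : Integrable (fun x => f1 (x, y)) γ := by
    rw [e1]
    exact hσi.indicator mx1
  have j2 : Integrable (fun x => f2 (x, y)) γ := by
    rw [e2]
    exact (integrable_const 1).indicator mx2
  rw [integral_sub (j1.const_mul s) (j2.const_mul _), integral_const_mul,
    integral_const_mul] at hy
  set J := ∫ x, f1 (x, y) ∂γ with hJ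
  have hB : ∫ x, f2 (x, y) ∂γ = γ.real {x | sg γ p x ≤ δ ∧ K * δ < |dirD p x y|} := by
    rw [e2, integral_indicator_const _ mx2, smul_eq_mul, mul_one]
  rw [hB] at hy
  set B := γ.real {x | sg γ p x ≤ δ ∧ K * δ < |dirD p x y|} with hBdef
  have hB0 : 0 ≤ B := measureReal_nonneg
  have hJw : J ≤ w := by
    refine integral_mono j1 hσi fun x => ?_
    simp only [f1]
    exact Set.indicator_le_self' (fun _ _ => sg_nonneg γ p _) _
  have hqi : Integrable (fun x => |dirD p x y|) γ := by
    have := (integrable_eval γ (dirP p y)).abs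
    simpa only [eval_dirP] using this
  have hJq : J ≤ ∫ x, |dirD p x y| ∂γ := by
    refine integral_mono j1 hqi fun x => ?_
    change f1 (x, y) ≤ _
    simp only [f1, Set.indicator]
    split_ifs with h
    · exact h
    · exact abs_nonneg _
  have h1 : c * w / 2 ≤ J := by
    have : s * (c * w / 2) ≤ s * J := by nlinarith [mul_nonneg hw.le hB0]
    exact le_of_mul_le_mul_left this hs
  have h2 : B ≤ s / 2 := by
    have : w * B ≤ w * (s / 2) := by
      nlinarith [mul_le_mul_of_nonneg_left hJw hs.le, mul_pos (mul_pos hs hw) hc]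
    exact le_of_mul_le_mul_left this hw
  have h3 : s / 2 ≤ γ.real {x | |MvPolynomial.eval x (dirP p y)| ≤ K * δ} := by
    have : s ≤ γ.real {x | |MvPolynomial.eval x (dirP p y)| ≤ K * δ} + B := by
      refine le_trans (measureReal_mono (fun x hx => ?_)) (measureReal_union_le _ _)
      by_cases h : |dirD p x y| ≤ K * δ
      · left
        simpa only [Set.mem_ofPred_eq, eval_dirP] using h
      · right
        exact ⟨hx, not_le.mp h⟩
    linarith
  have h4 := IH (dirP p y) (totalDegree_dirP p hp y) (K * δ) (by positivity) (by linarith)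
  refine le_trans ?_ h4
  have h5 : c * w / 2 ≤ ∫ x, |MvPolynomial.eval x (dirP p y)| ∂γ := by
    simp only [eval_dirP]
    exact h1.trans hJq
  have : 0 < c * w / 2 := by positivity
  gcongr

lemma continuous_rot {d : ℕ} :
    Continuous (fun u : ((Fin d → ℝ) × (Fin d → ℝ)) × ℝ =>
      ((rotX u.1.1 u.1.2 u.2, rotY u.1.1 u.1.2 u.2) : (Fin d → ℝ) × (Fin d → ℝ))) := by
  unfold rotX rotY
  fun_prop

lemma rot_avg {d : ℕ} (γ : Measure (Fin d → ℝ)) [IsGaussian γ] (hγ : ∫ x, x ∂γ = 0)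
    (G : (Fin d → ℝ) × (Fin d → ℝ) → ENNReal) (hG : Measurable G) :
    ∫⁻ z, (∫⁻ θ in Set.Ioo 0 (2 * π), G (rotX z.1 z.2 θ, rotY z.1 z.2 θ)) ∂(γ.prod γ) =
      ENNReal.ofReal (2 * π) * ∫⁻ z, G z ∂(γ.prod γ) := by
  have hm : AEMeasurable (Function.uncurry fun (z : (Fin d → ℝ) × (Fin d → ℝ)) (θ : ℝ) =>
      G (rotX z.1 z.2 θ, rotY z.1 z.2 θ))
      ((γ.prod γ).prod (volume.restrict (Set.Ioo 0 (2 * π)))) :=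
    (hG.comp continuous_rot.measurable).aemeasurable
  rw [lintegral_lintegral_swap hm]
  have h : ∀ θ : ℝ, ∫⁻ z, G (rotX z.1 z.2 θ, rotY z.1 z.2 θ) ∂(γ.prod γ) =
      ∫⁻ z, G z ∂(γ.prod γ) := by
    intro θ
    have h1 := IsGaussian.map_rotation_eq_self (μ := γ) (by simpa using hγ) θ
    conv_rhs => rw [← h1]
    rw [lintegral_map hG (by fun_prop)]
    refine lintegral_congr fun z => ?_
    rw [ContinuousLinearMap.rotation_apply]
    rfl
  simp_rw [h]
  rw [lintegral_const, mul_comm]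
  simp

lemma rot_osc {d : ℕ} (p : MvPolynomial (Fin d) ℝ) (x y : Fin d → ℝ) (a b : ℝ)
    (ha : a ∈ Set.Icc 0 (2 * π)) (hb : b ∈ Set.Icc 0 (2 * π)) :
    ENNReal.ofReal |MvPolynomial.eval (rotX x y b) p - MvPolynomial.eval (rotX x y a) p| ≤
      ∫⁻ θ in Set.Ioo 0 (2 * π), ENNReal.ofReal |dirD p (rotX x y θ) (rotY x y θ)| := by
  have hc : Continuous (fun θ => dirD p (rotX x y θ) (rotY x y θ)) :=
    (continuous_dirD p).comp (continuous_rot.comp (Continuous.prodMk_right (x, y)))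
  rw [← intervalIntegral.integral_eq_sub_of_hasDerivAt (fun θ _ => hasDerivAt_rot p x y θ)
    (hc.intervalIntegrable _ _)]
  have h1 := intervalIntegral.norm_integral_le_integral_norm_uIoc (μ := volume)
    (f := fun θ => dirD p (rotX x y θ) (rotY x y θ)) (a := a) (b := b)
  simp only [Real.norm_eq_abs] at h1
  refine (ENNReal.ofReal_le_ofReal h1).trans ?_
  rw [ofReal_integral_eq_lintegral_ofReal]
  · rw [setLIntegral_congr Ioo_ae_eq_Icc]
    refine lintegral_mono_set ?_
    exact Set.uIoc_subset_uIcc.trans (Set.uIcc_subset_Icc ha hb)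
  · exact (hc.abs.integrableOn_uIcc).mono_set Set.uIoc_subset_uIcc
  · exact ae_of_all _ fun θ => abs_nonneg _

lemma lint_dirD_le {d : ℕ} (γ : Measure (Fin d → ℝ)) [IsGaussian γ]
    (p : MvPolynomial (Fin d) ℝ) :
    ∫⁻ z, ENNReal.ofReal |dirD p z.1 z.2| ∂(γ.prod γ) ≤ ENNReal.ofReal (∫ x, sg γ p x ∂γ) := by
  rw [← ofReal_integral_eq_lintegral_ofReal (integrable_dirD γ p).abs
    (ae_of_all _ fun θ => abs_nonneg _)]
  refine ENNReal.ofReal_le_ofReal ?_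
  rw [integral_prod _ (integrable_dirD γ p).abs]
  exact integral_mono (integrable_dirD γ p).abs.integral_prod_left (integrable_sg γ p)
    fun x => integral_abs_dirD_le γ p x

lemma lint_osc_le {d : ℕ} (γ : Measure (Fin d → ℝ)) [IsGaussian γ] (hγ : ∫ x, x ∂γ = 0)
    (p : MvPolynomial (Fin d) ℝ) :
    ∫⁻ z, (∫⁻ θ in Set.Ioo 0 (2 * π),
      ENNReal.ofReal |dirD p (rotX z.1 z.2 θ) (rotY z.1 z.2 θ)|) ∂(γ.prod γ) ≤
      ENNReal.ofReal (2 * π) * ENNReal.ofReal (∫ x, sg γ p x ∂γ) := by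
  have h := rot_avg γ hγ (fun z => ENNReal.ofReal |dirD p z.1 z.2|)
    ((continuous_dirD p).abs.measurable.ennreal_ofReal)
  rw [h]
  gcongr
  exact lint_dirD_le γ p

lemma lint_diff_le {d : ℕ} (γ : Measure (Fin d → ℝ)) [IsGaussian γ] (hγ : ∫ x, x ∂γ = 0)
    (p : MvPolynomial (Fin d) ℝ) :
    ∫⁻ z, ENNReal.ofReal |MvPolynomial.eval z.1 p - MvPolynomial.eval z.2 p| ∂(γ.prod γ) ≤
      ENNReal.ofReal (2 * π) * ENNReal.ofReal (∫ x, sg γ p x ∂γ) := by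
  refine (lintegral_mono fun z => ?_).trans (lint_osc_le γ hγ p)
  have := rot_osc p z.1 z.2 (π / 2) 0 ⟨by positivity, by linarith [pi_pos]⟩
    ⟨le_rfl, by positivity⟩
  simpa [rotX] using this

lemma part1 {d M : ℕ} (γ : Measure (Fin d → ℝ)) [IsGaussian γ] (hγ : ∫ x, x ∂γ = 0)
    (p : MvPolynomial (Fin d) ℝ) (hp : p.totalDegree ≤ M) (t δ : ℝ) (hδ : 0 < δ)
    (ht : 0 ≤ t) (htN : 2 * t ≤ ∫ x, |MvPolynomial.eval x p| ∂γ) :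
    δ * (∫ x, |MvPolynomial.eval x p| ∂γ) * (γ.prod γ).real
      {z | |MvPolynomial.eval z.1 p| ≤ t ∧ δ ≤ |dirD p z.1 z.2|} ≤
      2 ^ (2 * M) * 8 * t * ∫ x, sg γ p x ∂γ := by
  set N := ∫ x, |MvPolynomial.eval x p| ∂γ with hN
  set w := ∫ x, sg γ p x ∂γ with hw
  have hw0 : 0 ≤ w := integral_nonneg fun x => sg_nonneg γ p x
  have hN0 : 0 ≤ N := integral_nonneg fun x => abs_nonneg _
  have hpm : Measurable (fun x => MvPolynomial.eval x p) :=
    (MvPolynomial.continuous_eval p).measurable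
  have hNe : ENNReal.ofReal N = ∫⁻ x, ENNReal.ofReal |MvPolynomial.eval x p| ∂γ :=
    ofReal_integral_eq_lintegral_ofReal (integrable_eval γ p).abs
      (ae_of_all _ fun θ => abs_nonneg _)
  set Q : Set ((Fin d → ℝ) × (Fin d → ℝ)) :=
    {z | |MvPolynomial.eval z.1 p| ≤ t ∧ δ ≤ |dirD p z.1 z.2|} with hQ
  have mQ : MeasurableSet Q :=
    (measurableSet_le (hpm.comp measurable_fst).abs measurable_const).inter
      (measurableSet_le measurable_const (continuous_dirD p).abs.measurable)
  set D : (Fin d → ℝ) × (Fin d → ℝ) → ENNReal := fun z => ∫⁻ θ in Set.Ioo 0 (2 * π),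
      ENNReal.ofReal |dirD p (rotX z.1 z.2 θ) (rotY z.1 z.2 θ)| with hD
  set A : (Fin d → ℝ) → ENNReal := fun x =>
    ∫⁻ y, ENNReal.ofReal |MvPolynomial.eval x p - MvPolynomial.eval y p| ∂γ with hA
  have mdiff : Measurable (fun z : (Fin d → ℝ) × (Fin d → ℝ) =>
      ENNReal.ofReal |MvPolynomial.eval z.1 p - MvPolynomial.eval z.2 p|) :=
    ((hpm.comp measurable_fst).sub (hpm.comp measurable_snd)).abs.ennreal_ofReal
  have mA : Measurable A := mdiff.lintegral_prod_right'
  have key : ∀ z : (Fin d → ℝ) × (Fin d → ℝ),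
      ENNReal.ofReal δ * ENNReal.ofReal N *
        (∫⁻ θ in Set.Ioo 0 (2 * π), Q.indicator 1 (rotX z.1 z.2 θ, rotY z.1 z.2 θ)) ≤
      2 ^ (2 * M) * ENNReal.ofReal (2 * t) * (2 * (D z + A z.1)) := by
    intro z
    set V : Set ℝ := {θ | |MvPolynomial.eval (rotX z.1 z.2 θ) p| ≤ t ∧
      δ ≤ |dirD p (rotX z.1 z.2 θ) (rotY z.1 z.2 θ)|} with hV
    have hc : Continuous (fun θ => dirD p (rotX z.1 z.2 θ) (rotY z.1 z.2 θ)) :=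
      (continuous_dirD p).comp (continuous_rot.comp (Continuous.prodMk_right z))
    have hrm : Measurable (fun θ : ℝ => ((rotX z.1 z.2 θ, rotY z.1 z.2 θ) :
        (Fin d → ℝ) × (Fin d → ℝ))) :=
      (continuous_rot.comp (Continuous.prodMk_right z)).measurable
    have mV : MeasurableSet V := hrm mQ
    have e : (∫⁻ θ in Set.Ioo 0 (2 * π),
        Q.indicator (1 : (Fin d → ℝ) × (Fin d → ℝ) → ENNReal)
          (rotX z.1 z.2 θ, rotY z.1 z.2 θ)) = volume (V ∩ Set.Ioo 0 (2 * π)) := by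
      rw [← Measure.restrict_apply mV, ← lintegral_indicator_one mV]
      rfl
    rw [e]
    have hl := Trig.level (trig_rot p hp z.1 z.2) (hasDerivAt_rot p z.1 z.2) hc t δ hδ
    rcases Set.eq_empty_or_nonempty (V ∩ Set.Ioo 0 (2 * π)) with h0 | ⟨θ, hθV, hθ⟩
    · rw [h0]
      simp
    have h1 : ENNReal.ofReal |MvPolynomial.eval z.1 p| ≤ ENNReal.ofReal t + D z := by
      have h2 := rot_osc p z.1 z.2 θ 0 ⟨hθ.1.le, hθ.2.le⟩ ⟨le_rfl, by positivity⟩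
      have h3 : rotX z.1 z.2 0 = z.1 := by simp [rotX]
      rw [h3] at h2
      refine le_trans ?_ (add_le_add_right h2 _)
      rw [← ENNReal.ofReal_add ht (abs_nonneg _)]
      refine ENNReal.ofReal_le_ofReal ?_
      have h4 : |MvPolynomial.eval (rotX z.1 z.2 θ) p| ≤ t := hθV.1
      have h5 := abs_sub_abs_le_abs_sub (MvPolynomial.eval z.1 p)
        (MvPolynomial.eval (rotX z.1 z.2 θ) p)
      linarith
    have h2 : ENNReal.ofReal N ≤ ENNReal.ofReal |MvPolynomial.eval z.1 p| + A z.1 := by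
      have h3 : ENNReal.ofReal |MvPolynomial.eval z.1 p| =
          ∫⁻ _, ENNReal.ofReal |MvPolynomial.eval z.1 p| ∂γ := by simp
      rw [hNe, h3, hA, ← lintegral_add_left measurable_const]
      refine lintegral_mono fun y => ?_
      rw [← ENNReal.ofReal_add (abs_nonneg _) (abs_nonneg _)]
      refine ENNReal.ofReal_le_ofReal ?_
      have h5 := abs_sub_abs_le_abs_sub (MvPolynomial.eval y p) (MvPolynomial.eval z.1 p)
      rw [abs_sub_comm] at h5
      linarith
    have h3 : ENNReal.ofReal N ≤ 2 * (D z + A z.1) := by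
      have h4 : ENNReal.ofReal N ≤ ENNReal.ofReal t + (D z + A z.1) := by
        rw [← add_assoc]
        exact h2.trans (add_le_add_left h1 _)
      have h5 : 2 * ENNReal.ofReal t ≤ ENNReal.ofReal N := by
        rw [← ENNReal.ofReal_ofNat 2, ← ENNReal.ofReal_mul (by norm_num)]
        exact ENNReal.ofReal_le_ofReal htN
      have h6 : ENNReal.ofReal N + ENNReal.ofReal N ≤
          ENNReal.ofReal N + 2 * (D z + A z.1) := by
        rw [← two_mul]
        refine (mul_le_mul_right h4 2).trans ?_
        rw [mul_add]
        exact add_le_add_left h5 _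
      exact (ENNReal.add_le_add_iff_left ENNReal.ofReal_ne_top).1 h6
    calc ENNReal.ofReal δ * ENNReal.ofReal N * volume (V ∩ Set.Ioo 0 (2 * π))
        = (ENNReal.ofReal δ * volume (V ∩ Set.Ioo 0 (2 * π))) * ENNReal.ofReal N := by ring
      _ ≤ _ := mul_le_mul' hl h3
  have hInt := lintegral_mono (μ := γ.prod γ) key
  have mQi : Measurable (Q.indicator (1 : (Fin d → ℝ) × (Fin d → ℝ) → ENNReal)) :=
    measurable_one.indicator mQ
  have mD : Measurable D :=
    (((continuous_dirD p).abs.measurable.ennreal_ofReal).comp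
      continuous_rot.measurable).lintegral_prod_right'
  rw [lintegral_const_mul' _ _ (by finiteness), rot_avg γ hγ _ mQi, lintegral_indicator_one mQ,
    lintegral_const_mul' _ _ (by finiteness), lintegral_const_mul' _ _ (by finiteness),
    lintegral_add_left mD] at hInt
  have hAz : ∫⁻ z, A z.1 ∂(γ.prod γ) ≤ ENNReal.ofReal (2 * π) * ENNReal.ofReal w := by
    refine le_trans (le_of_eq ?_) (lint_diff_le γ hγ p)
    have mA1 : AEMeasurable (fun z : (Fin d → ℝ) × (Fin d → ℝ) => A z.1) (γ.prod γ) :=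
      (mA.comp measurable_fst).aemeasurable
    rw [lintegral_prod _ mA1, lintegral_prod _ mdiff.aemeasurable]
    simp [hA]
  have hfin := hInt.trans (mul_le_mul_right (mul_le_mul_right
    (add_le_add (lint_osc_le γ hγ p) hAz) 2) _)
  have hfin2 := ENNReal.toReal_mono (by finiteness) hfin
  have e2 : ENNReal.toReal (ENNReal.ofReal (2 * π) * ENNReal.ofReal w +
      ENNReal.ofReal (2 * π) * ENNReal.ofReal w) = 4 * π * w := by
    rw [ENNReal.toReal_add (by finiteness) (by finiteness), ENNReal.toReal_mul,
      ENNReal.toReal_ofReal (by positivity), ENNReal.toReal_ofReal hw0]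
    ring
  rw [← hw] at hfin2
  simp only [ENNReal.toReal_mul, e2, ENNReal.toReal_ofReal hδ.le, ENNReal.toReal_ofReal hN0,
    ENNReal.toReal_ofReal (show 0 ≤ 2 * π by positivity), ENNReal.toReal_pow,
    ENNReal.toReal_ofReal (show 0 ≤ 2 * t by positivity), ENNReal.toReal_ofNat] at hfin2
  change δ * N * (2 * π * (γ.prod γ).real Q) ≤ _ at hfin2
  have h2pi : 0 < 2 * π := by positivity
  refine le_of_mul_le_mul_left ?_ h2pi
  calc 2 * π * (δ * N * (γ.prod γ).real Q) = δ * N * (2 * π * (γ.prod γ).real Q) := by ring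
    _ ≤ _ := hfin2
    _ = _ := by ring

lemma prod_lower {d : ℕ} {c : ℝ} (hc : 0 < c) (γ : Measure (Fin d → ℝ)) [IsGaussian γ]
    (p : MvPolynomial (Fin d) ℝ)
    (hg : ∀ x, c ≤ γ.real {y | sg γ p x ≤ |dirD p x y|}) (t δ : ℝ) :
    c * γ.real {x | |MvPolynomial.eval x p| ≤ t ∧ δ ≤ sg γ p x} ≤
      (γ.prod γ).real {z | |MvPolynomial.eval z.1 p| ≤ t ∧ δ ≤ |dirD p z.1 z.2|} := by
  have hpm : Measurable (fun x => MvPolynomial.eval x p) :=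
    (MvPolynomial.continuous_eval p).measurable
  set Q : Set ((Fin d → ℝ) × (Fin d → ℝ)) :=
    {z | |MvPolynomial.eval z.1 p| ≤ t ∧ δ ≤ |dirD p z.1 z.2|} with hQ
  have mQ : MeasurableSet Q :=
    (measurableSet_le (hpm.comp measurable_fst).abs measurable_const).inter
      (measurableSet_le measurable_const (continuous_dirD p).abs.measurable)
  set E : Set (Fin d → ℝ) := {x | |MvPolynomial.eval x p| ≤ t ∧ δ ≤ sg γ p x} with hE
  have mE : MeasurableSet E :=
    (measurableSet_le hpm.abs measurable_const).inter
      (measurableSet_le measurable_const (measurable_sg γ p))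
  have h : ENNReal.ofReal c * γ E ≤ (γ.prod γ) Q := by
    rw [Measure.prod_apply mQ, ← lintegral_indicator_const mE]
    refine lintegral_mono fun x => ?_
    by_cases hx : x ∈ E
    · rw [Set.indicator_of_mem hx]
      refine (ENNReal.ofReal_le_ofReal (hg x)).trans ?_
      rw [ofReal_measureReal]
      refine measure_mono fun y hy => ?_
      exact ⟨hx.1, hx.2.trans hy⟩
    · rw [Set.indicator_of_notMem hx]
      exact zero_le
  have h2 := ENNReal.toReal_mono (measure_ne_top _ _) h
  rw [ENNReal.toReal_mul, ENNReal.toReal_ofReal hc.le] at h2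
  exact h2

lemma case_zero {d : ℕ} (γ : Measure (Fin d → ℝ)) [IsGaussian γ] (hγ : ∫ x, x ∂γ = 0)
    (p : MvPolynomial (Fin d) ℝ) (t : ℝ) (hw : ∫ x, sg γ p x ∂γ = 0)
    (hb : 0 < γ.real {x | |MvPolynomial.eval x p| ≤ t}) :
    ∫ x, |MvPolynomial.eval x p| ∂γ ≤ t := by
  have h := lint_diff_le γ hγ p
  rw [hw, ENNReal.ofReal_zero, mul_zero] at h
  have hpm : Measurable (fun x => MvPolynomial.eval x p) :=
    (MvPolynomial.continuous_eval p).measurable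
  have mdiff : Measurable (fun z : (Fin d → ℝ) × (Fin d → ℝ) =>
      ENNReal.ofReal |MvPolynomial.eval z.1 p - MvPolynomial.eval z.2 p|) :=
    ((hpm.comp measurable_fst).sub (hpm.comp measurable_snd)).abs.ennreal_ofReal
  have h1 := (lintegral_eq_zero_iff mdiff).1 (le_antisymm h zero_le)
  have h2 := Measure.ae_ae_of_ae_prod h1
  have h3 : ∃ᵐ x ∂γ, |MvPolynomial.eval x p| ≤ t := by
    rw [frequently_ae_iff]
    intro h0
    rw [measureReal_def, h0] at hb
    simp at hb
  obtain ⟨x, hx1, hx2⟩ := (h3.and_eventually h2).exists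
  have h4 : (fun y => |MvPolynomial.eval y p|) =ᵐ[γ] fun _ => |MvPolynomial.eval x p| := by
    filter_upwards [hx2] with y hy
    simp only [Pi.zero_apply, ENNReal.ofReal_eq_zero] at hy
    have := abs_nonpos_iff.1 hy
    rw [sub_eq_zero.1 this]
  rw [integral_congr_ae h4]
  simpa using hx1

lemma claim (m : ℕ) : ∃ C : ℝ, 0 < C ∧
    ∀ (d : ℕ) (γ : Measure (Fin d → ℝ)) [IsGaussian γ] (_ : ∫ x, x ∂γ = 0)
      (p : MvPolynomial (Fin d) ℝ), p.totalDegree ≤ m → ∀ t : ℝ, 0 ≤ t →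
      0 < γ.real {x | |MvPolynomial.eval x p| ≤ t} →
      γ.real {x | |MvPolynomial.eval x p| ≤ t} ^ m * ∫ x, |MvPolynomial.eval x p| ∂γ ≤ C * t := by
  induction m with
  | zero =>
    refine ⟨1, one_pos, fun d γ _ hγ p hp t ht hb => ?_⟩
    have hp0 := MvPolynomial.totalDegree_eq_zero_iff_eq_C.1 (Nat.le_zero.1 hp)
    set a := p.coeff 0
    rw [hp0] at hb ⊢
    simp only [MvPolynomial.eval_C] at hb ⊢
    have : |a| ≤ t := by
      by_contra h
      simp [h] at hb
    simpa using this
  | succ m ih =>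
    obtain ⟨C, hC, IH⟩ := ih
    obtain ⟨c, K, hc, hK, hg⟩ := gauss_facts
    refine ⟨2 + 4 ^ m * 8 * C * K / c ^ 2 * (2 ^ (2 * (m + 1)) * 8), by positivity,
      fun d γ _ hγ p hp t ht hb => ?_⟩
    set b := γ.real {x | |MvPolynomial.eval x p| ≤ t} with hbdef
    set N := ∫ x, |MvPolynomial.eval x p| ∂γ with hN
    have hb1 : b ≤ 1 := measureReal_le_one
    have hN0 : 0 ≤ N := integral_nonneg fun x => abs_nonneg _
    have hCt : 0 ≤ 4 ^ m * 8 * C * K / c ^ 2 * (2 ^ (2 * (m + 1)) * 8) * t := by positivity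
    have hbN : b ^ (m + 1) * N ≤ N := by
      have := pow_le_one₀ (n := m + 1) hb.le hb1
      nlinarith
    rcases lt_or_ge N (2 * t) with htN | htN
    · linarith
    have hw0 : 0 ≤ ∫ x, sg γ p x ∂γ := integral_nonneg fun x => sg_nonneg γ p x
    rcases hw0.eq_or_lt with hw | hw
    · have := case_zero γ hγ p t hw.symm hb
      rw [← hN] at this
      linarith
    have P2 := fun δ hδ => part2 hc hK γ p hp (hg d γ hγ p) (IH d γ hγ) δ hδ hw
    have P1 := fun δ hδ => part1 γ hγ p hp t δ hδ ht htN
    set w := ∫ x, sg γ p x ∂γ with hwdef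
    set δ := (b / 4) ^ m * c * w / (4 * C * K) with hδdef
    have hδ : 0 < δ := by positivity
    have hs : γ.real {x | sg γ p x ≤ δ} ≤ b / 2 := by
      by_contra! h
      have h1 := P2 δ hδ.le (by linarith)
      have h2 : (b / 4) ^ m * (c * w / 2) ≤ C * (K * δ) := by
        refine le_trans ?_ h1
        have : b / 4 ≤ γ.real {x | sg γ p x ≤ δ} / 2 := by linarith
        gcongr
      have h3 : C * (K * δ) = (b / 4) ^ m * (c * w / 2) / 2 := by
        rw [hδdef]
        field_simp
        norm_num
      have h4 : 0 < (b / 4) ^ m * (c * w / 2) := by positivity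
      linarith
    have hE : b / 2 ≤ γ.real {x | |MvPolynomial.eval x p| ≤ t ∧ δ ≤ sg γ p x} := by
      have : b ≤ γ.real {x | |MvPolynomial.eval x p| ≤ t ∧ δ ≤ sg γ p x} +
          γ.real {x | sg γ p x ≤ δ} := by
        refine le_trans (measureReal_mono (fun x hx => ?_)) (measureReal_union_le _ _)
        rcases le_total δ (sg γ p x) with h | h
        · exact Or.inl ⟨hx, h⟩
        · exact Or.inr h
      linarith
    have hQ := prod_lower hc γ p (fun x => (hg d γ hγ p x).1) t δ
    have h1 := P1 δ hδ
    have h2 : δ * N * (c * (b / 2)) ≤ 2 ^ (2 * (m + 1)) * 8 * t * w := by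
      refine le_trans ?_ h1
      refine mul_le_mul_of_nonneg_left ?_ (by positivity)
      exact le_trans (mul_le_mul_of_nonneg_left hE hc.le) hQ
    have e : b ^ (m + 1) * N * w =
        4 ^ m * 8 * C * K / c ^ 2 * (δ * N * (c * (b / 2))) := by
      rw [hδdef, div_pow, pow_succ]
      field_simp
      ring
    have h3 : b ^ (m + 1) * N * w ≤
        4 ^ m * 8 * C * K / c ^ 2 * (2 ^ (2 * (m + 1)) * 8) * t * w := by
      rw [e]
      calc _ ≤ 4 ^ m * 8 * C * K / c ^ 2 * (2 ^ (2 * (m + 1)) * 8 * t * w) := by gcongr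
        _ = _ := by ring
    have h4 := le_of_mul_le_mul_right h3 hw
    linarith

/-- The standard Gaussian measure on `Fin d → ℝ`. -/
def stdG (d : ℕ) : Measure (Fin d → ℝ) := Measure.pi (fun _ => gaussianReal 0 1)

lemma stdG_eq_map (d : ℕ) : stdG d =
    (stdGaussian (EuclideanSpace ℝ (Fin d))).map (EuclideanSpace.equiv (Fin d) ℝ) := by
  rw [← map_pi_eq_stdGaussian, Measure.map_map (by fun_prop) (by fun_prop)]
  have : (EuclideanSpace.equiv (Fin d) ℝ) ∘ (WithLp.toLp 2 : (Fin d → ℝ) → _) = id := by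
    funext x
    rfl
  rw [this, Measure.map_id]
  rfl

instance isGaussian_stdG (d : ℕ) : IsGaussian (stdG d) := by
  rw [stdG_eq_map]
  infer_instance

lemma mean_stdG (d : ℕ) : ∫ x, x ∂(stdG d) = 0 := by
  rw [stdG_eq_map, integral_map (by fun_prop) (by fun_prop),
    ContinuousLinearEquiv.integral_comp_comm, integral_id_stdGaussian, map_zero]

lemma stdG_density (d : ℕ) : stdG d = volume.withDensity
    (fun x => ENNReal.ofReal (∏ i, gaussianPDFReal 0 1 (x i))) := by
  refine Measure.pi_eq fun s hs => ?_
  have ms : MeasurableSet (Set.univ.pi s) := MeasurableSet.univ_pi hs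
  rw [withDensity_apply _ ms, ← lintegral_indicator ms]
  have e : (Set.univ.pi s).indicator
      (fun x : Fin d → ℝ => ENNReal.ofReal (∏ i, gaussianPDFReal 0 1 (x i))) =
      fun x => ENNReal.ofReal (∏ i, (s i).indicator (gaussianPDFReal 0 1) (x i)) := by
    funext x
    by_cases hx : x ∈ Set.univ.pi s
    · rw [Set.indicator_of_mem hx]
      congr 1
      refine Finset.prod_congr rfl fun i _ => ?_
      rw [Set.indicator_of_mem (hx i (Set.mem_univ i))]
    · rw [Set.indicator_of_notMem hx]
      simp only [Set.mem_univ_pi, not_forall] at hx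
      obtain ⟨i, hi⟩ := hx
      rw [Finset.prod_eq_zero (Finset.mem_univ i) (Set.indicator_of_notMem hi _)]
      simp
  have hi : ∀ i, Integrable ((s i).indicator (gaussianPDFReal 0 1)) volume := fun i =>
    (integrable_gaussianPDFReal 0 1).indicator (hs i)
  have hn : ∀ i u, 0 ≤ (s i).indicator (gaussianPDFReal 0 1) u := fun i u =>
    Set.indicator_nonneg (fun _ _ => gaussianPDFReal_nonneg 0 1 _) _
  have hprod : Integrable (fun x : Fin d → ℝ =>
      ∏ i, (s i).indicator (gaussianPDFReal 0 1) (x i)) volume := by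
    rw [volume_pi]
    exact Integrable.fintype_prod hi
  rw [e, ← ofReal_integral_eq_lintegral_ofReal hprod
    (ae_of_all _ fun x => Finset.prod_nonneg fun i _ => hn i _),
    integral_fintype_prod_volume_eq_prod (fun i => (s i).indicator (gaussianPDFReal 0 1)),
    ENNReal.ofReal_prod_of_nonneg fun i _ => integral_nonneg (hn i)]
  refine Finset.prod_congr rfl fun i _ => ?_
  rw [integral_indicator (hs i), ← gaussianReal_apply_eq_integral 0 (by simp)]

lemma exists_sqrt {d : ℕ} (Sg : Matrix (Fin d) (Fin d) ℝ) (h : Sg.PosDef) :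
    ∃ L : Matrix (Fin d) (Fin d) ℝ, L.det ≠ 0 ∧ Sg = L * Lᵀ := by
  open scoped MatrixOrder Matrix.Norms.L2Operator in
  obtain ⟨B, hB⟩ := CStarAlgebra.nonneg_iff_eq_star_mul_self.1 h.posSemidef.nonneg
  have hB' : Sg = Bᵀ * B := by
    rw [hB, Matrix.star_eq_conjTranspose, Matrix.conjTranspose_eq_transpose_of_trivial]
  refine ⟨Bᵀ, fun h0 => ?_, by rw [Matrix.transpose_transpose]; exact hB'⟩
  have := h.det_pos
  rw [hB', Matrix.det_mul, h0, zero_mul] at this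
  exact lt_irrefl _ this

lemma gpdf_affine {d : ℕ} (μ : Fin d → ℝ) (L : Matrix (Fin d) (Fin d) ℝ) (hL : L.det ≠ 0)
    (x : Fin d → ℝ) :
    |L.det| * gpdf μ (L * Lᵀ) (μ + L *ᵥ x) = ∏ i, gaussianPDFReal 0 1 (x i) := by
  have hu : IsUnit L.det := isUnit_iff_ne_zero.2 hL
  have hut : IsUnit Lᵀ.det := by rwa [Matrix.det_transpose]
  have hq : (L *ᵥ x) ⬝ᵥ ((L * Lᵀ)⁻¹ *ᵥ (L *ᵥ x)) = ∑ i, x i ^ 2 := by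
    rw [Matrix.mul_inv_rev, Matrix.mulVec_mulVec, Matrix.mul_assoc,
      Matrix.nonsing_inv_mul _ hu, Matrix.mul_one, Matrix.dotProduct_mulVec,
      Matrix.vecMul_mulVec, Matrix.mul_nonsing_inv _ hut]
    simp [dotProduct, pow_two]
  have hd : Real.sqrt ((2 * π) ^ d * (L * Lᵀ).det) = |L.det| * Real.sqrt (2 * π) ^ d := by
    rw [Matrix.det_mul, Matrix.det_transpose, Real.sqrt_mul (by positivity),
      Real.sqrt_mul_self_eq_abs, mul_comm]
    congr 1
    rw [Real.sqrt_eq_iff_mul_self_eq (by positivity) (by positivity), ← mul_pow,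
      Real.mul_self_sqrt (by positivity)]
  have hp : ∏ i, gaussianPDFReal 0 1 (x i) =
      (Real.sqrt (2 * π) ^ d)⁻¹ * Real.exp (-(1 / 2) * ∑ i, x i ^ 2) := by
    simp only [gaussianPDFReal]
    rw [Finset.prod_mul_distrib, Finset.prod_const, ← Real.exp_sum, Finset.mul_sum]
    simp only [Finset.card_univ, Fintype.card_fin, NNReal.coe_one, mul_one, sub_zero, inv_pow]
    congr 2
    exact Finset.sum_congr rfl fun i _ => by ring
  rw [gpdf, add_sub_cancel_left, hq, hd, hp, mul_inv]
  have : |L.det| ≠ 0 := abs_ne_zero.2 hL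
  field_simp

lemma measurable_gpdf {d : ℕ} (μ : Fin d → ℝ) (Sg : Matrix (Fin d) (Fin d) ℝ) :
    Measurable (gpdf μ Sg) := by
  have : Continuous (gpdf μ Sg) := by
    unfold gpdf
    fun_prop
  exact this.measurable

lemma gauss_eq_map {d : ℕ} (μ : Fin d → ℝ) (L : Matrix (Fin d) (Fin d) ℝ) (hL : L.det ≠ 0) :
    gauss μ (L * Lᵀ) = (stdG d).map (fun x => μ + L *ᵥ x) := by
  have hLc : Continuous (fun x : Fin d → ℝ => L *ᵥ x) := by fun_prop
  have hvol : (volume : Measure (Fin d → ℝ)) =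
      ENNReal.ofReal |L.det| • Measure.map (fun x => L *ᵥ x) volume := by
    have h1 := Real.map_matrix_volume_pi_eq_smul_volume_pi hL
    have h2 : (fun x => L *ᵥ x) = ⇑(Matrix.toLin' L) := by
      funext x
      simp
    rw [h2, h1, smul_smul, ← ENNReal.ofReal_mul (abs_nonneg _), ← abs_mul, mul_inv_cancel₀ hL]
    simp
  have key : ∀ f : (Fin d → ℝ) → ENNReal, Measurable f →
      ∫⁻ z, f z = ENNReal.ofReal |L.det| * ∫⁻ x, f (μ + L *ᵥ x) := by
    intro f hf
    rw [← lintegral_add_left_eq_self f μ]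
    conv_lhs => rw [hvol]
    have hf' : Measurable (fun z => f (μ + z)) := hf.comp (measurable_const_add μ)
    rw [lintegral_smul_measure, lintegral_map hf' hLc.measurable, smul_eq_mul]
  have hT : Measurable (fun x : Fin d → ℝ => μ + L *ᵥ x) := by fun_prop
  ext s hs
  rw [Measure.map_apply hT hs, stdG_density, gauss, withDensity_apply _ hs,
    withDensity_apply _ (hT hs), ← lintegral_indicator hs, ← lintegral_indicator (hT hs),
    key _ ((measurable_gpdf _ _).ennreal_ofReal.indicator hs),
    ← lintegral_const_mul' _ _ ENNReal.ofReal_ne_top]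
  refine lintegral_congr fun x => ?_
  by_cases hx : μ + L *ᵥ x ∈ s
  · have hx' : x ∈ (fun x => μ + L *ᵥ x) ⁻¹' s := hx
    rw [Set.indicator_of_mem hx, Set.indicator_of_mem hx',
      ← ENNReal.ofReal_mul (abs_nonneg _), gpdf_affine μ L hL x]
  · have hx' : x ∉ (fun x => μ + L *ᵥ x) ⁻¹' s := hx
    rw [Set.indicator_of_notMem hx, Set.indicator_of_notMem hx', mul_zero]

/-- There is a universal constant `c > 0` such that for every `d ≥ 1`, every
nonnegative polynomial `p : ℝ^d → ℝ` of degree at most `4`, every normal `N(μ,Σ)` and every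
measurable `S` with `N(μ,Σ;S) ≥ β`, `β ∈ (0,1]`,
`E_{z ∼ N(μ,Σ,S)}[p(z)] ≥ c · β⁴ · E_{z ∼ N(μ,Σ)}[p(z)]`. -/
theorem statement7 :
    ∃ c : ℝ, 0 < c ∧
      ∀ d : ℕ, 1 ≤ d →
      ∀ p : MvPolynomial (Fin d) ℝ, p.totalDegree ≤ 4 →
        (∀ z : Fin d → ℝ, 0 ≤ MvPolynomial.eval z p) →
      ∀ (μ : Fin d → ℝ) (Sg : Matrix (Fin d) (Fin d) ℝ), Sg.PosDef →
      ∀ S : Set (Fin d → ℝ), MeasurableSet S →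
      ∀ β : ℝ, 0 < β → β ≤ 1 → ENNReal.ofReal β ≤ gauss μ Sg S →
        c * β ^ 4 * ∫ z, MvPolynomial.eval z p ∂(gauss μ Sg) ≤
          ∫ z, MvPolynomial.eval z p ∂(truncGauss μ Sg S) := by
  obtain ⟨C, hC, H⟩ := claim 4
  refine ⟨1 / (64 * C), by positivity, ?_⟩
  intro d _ p hp hp0 μ Sg hSg S hS β hβ _ hβS
  obtain ⟨L, hL, rfl⟩ := exists_sqrt Sg hSg
  obtain ⟨q, hq, hqe⟩ := exists_affine_comp p 4 hp μ L
  have hT : Measurable (fun x : Fin d → ℝ => μ + L *ᵥ x) := by fun_prop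
  have hν := gauss_eq_map μ L hL
  have hpc : Continuous (fun z => MvPolynomial.eval z p) := MvPolynomial.continuous_eval p
  set ν := gauss μ (L * Lᵀ) with hνdef
  have hprob : IsProbabilityMeasure ν := by
    rw [hν]
    exact Measure.isProbabilityMeasure_map hT.aemeasurable
  have hq0 : ∀ x, 0 ≤ MvPolynomial.eval x q := fun x => by
    rw [hqe]
    exact hp0 _
  have hE : ∫ z, MvPolynomial.eval z p ∂ν = ∫ x, |MvPolynomial.eval x q| ∂(stdG d) := by
    rw [hν, integral_map hT.aemeasurable hpc.aestronglyMeasurable]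
    refine integral_congr_ae (ae_of_all _ fun x => ?_)
    simp only [hqe, abs_of_nonneg (hp0 _)]
  have hInt : Integrable (fun z => MvPolynomial.eval z p) ν := by
    rw [hν, integrable_map_measure hpc.aestronglyMeasurable hT.aemeasurable]
    refine (integrable_eval (stdG d) q).congr (ae_of_all _ fun x => ?_)
    simp [hqe]
  have hSpos : β ≤ ν.real S := by
    rw [measureReal_def]
    exact (ENNReal.ofReal_le_iff_le_toReal (measure_ne_top _ _)).1 hβS
  set E := ∫ z, MvPolynomial.eval z p ∂ν with hEdef
  have hE0 : 0 ≤ E := integral_nonneg hp0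
  rcases hE0.eq_or_lt with h0 | hEpos
  · rw [← h0, mul_zero]
    exact integral_nonneg hp0
  set t := (β / 2) ^ 4 * E / (2 * C) with ht
  have htpos : 0 < t := by positivity
  set b := (stdG d).real {x | |MvPolynomial.eval x q| ≤ t} with hb
  have hbν : ν.real {z | MvPolynomial.eval z p ≤ t} = b := by
    rw [hν, map_measureReal_apply hT (measurableSet_le hpc.measurable measurable_const), hb]
    congr 1
    ext x
    simp only [Set.mem_preimage, Set.mem_ofPred_eq, hqe, abs_of_nonneg (hp0 _)]
  have hbβ : b ≤ β / 2 := by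
    by_contra! h
    have h1 := H d (stdG d) (mean_stdG d) q hq t htpos.le (by linarith)
    rw [← hE, ← hb] at h1
    have h2 : C * t = (β / 2) ^ 4 * E / 2 := by
      rw [ht]
      field_simp
    have h3 : (β / 2) ^ 4 * E ≤ b ^ 4 * E := by gcongr
    have h4 : 0 < (β / 2) ^ 4 * E := by positivity
    linarith
  have hS0 : 0 < ν.real S := by linarith
  have hA : ν.real S / 2 ≤ ν.real (S ∩ {z | t ≤ MvPolynomial.eval z p}) := by
    have : ν.real S ≤ ν.real (S ∩ {z | t ≤ MvPolynomial.eval z p}) +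
        ν.real {z | MvPolynomial.eval z p ≤ t} := by
      refine le_trans (measureReal_mono (fun x hx => ?_)) (measureReal_union_le _ _)
      rcases le_total t (MvPolynomial.eval x p) with h | h
      · exact Or.inl ⟨hx, h⟩
      · exact Or.inr h
    linarith
  have hci : Integrable (fun z => MvPolynomial.eval z p) (truncGauss μ (L * Lᵀ) S) := by
    unfold truncGauss ProbabilityTheory.cond
    refine (hInt.restrict).smul_measure ?_
    refine ENNReal.inv_ne_top.2 fun h => ?_
    rw [measureReal_def, h] at hS0
    simp at hS0
  have hM := mul_meas_ge_le_integral_of_nonneg (ae_of_all _ hp0) hci t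
  refine le_trans ?_ hM
  have hcr : 1 / 2 ≤ (truncGauss μ (L * Lᵀ) S).real {z | t ≤ MvPolynomial.eval z p} := by
    unfold truncGauss
    rw [measureReal_def, cond_apply hS, ENNReal.toReal_mul, ENNReal.toReal_inv, ← hνdef]
    change 1 / 2 ≤ (ν.real S)⁻¹ * ν.real (S ∩ {z | t ≤ MvPolynomial.eval z p})
    rw [inv_mul_eq_div, le_div_iff₀ hS0]
    linarith
  have h5 : 1 / (64 * C) * β ^ 4 * E = t * (1 / 2) := by
    rw [ht]
    field_simp
    norm_num
  rw [h5]
  exact mul_le_mul_of_nonneg_left hcr htpos.le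

end
end

section
/- Let μ ∈ ℝ^d, let Σ be symmetric positive definite, and let S ⊆ ℝ^d be measurable with N(μ,Σ;S) ≥ α for some α ∈ (0,1]. Then the covariance matrix Σ_S of the truncated normal N(μ,Σ,S) satisfies Σ_S ⪰ (α²/12) Σ; equivalently, for every unit vector r ∈ ℝ^d, Var_{x ∼ N(μ,Σ,S)}[rᵀ Σ^{−1/2}(x − μ)] ≥ α²/12. -/
open MeasureTheory ProbabilityTheory Matrix Real

noncomputable section

def P0 (d : ℕ) : Measure (Fin d → ℝ) := Measure.pi (fun _ => gaussianReal 0 1)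

instance (d : ℕ) : IsProbabilityMeasure (P0 d) := by unfold P0; infer_instance

lemma P0_eq (d : ℕ) : P0 d = volume.withDensity
    (fun z => ENNReal.ofReal (∏ i, gaussianPDFReal 0 1 (z i))) := by
  unfold P0
  symm
  refine Measure.pi_eq ?_ |>.symm
  intro s hs
  rw [withDensity_apply _ (MeasurableSet.univ_pi hs), ← lintegral_indicator (MeasurableSet.univ_pi hs)]
  have h1 : ∀ z : Fin d → ℝ, (Set.univ.pi s).indicator
      (fun z => ENNReal.ofReal (∏ i, gaussianPDFReal 0 1 (z i))) z
      = ENNReal.ofReal (∏ i, (s i).indicator (gaussianPDFReal 0 1) (z i)) := by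
    intro z
    by_cases hz : z ∈ Set.univ.pi s
    · rw [Set.indicator_of_mem hz]
      congr 1
      refine Finset.prod_congr rfl fun i _ => ?_
      rw [Set.indicator_of_mem (hz i trivial)]
    · rw [Set.indicator_of_notMem hz]
      simp only [Set.mem_pi, Set.mem_univ, true_imp_iff, not_forall] at hz
      obtain ⟨i, hi⟩ := hz
      rw [Finset.prod_eq_zero (Finset.mem_univ i)]
      · simp
      · simp [hi]
  simp_rw [h1]
  have hint : ∀ i, Integrable ((s i).indicator (gaussianPDFReal 0 1)) volume := fun i =>
    (integrable_gaussianPDFReal 0 1).indicator (hs i)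
  have hnn : ∀ i x, 0 ≤ (s i).indicator (gaussianPDFReal 0 1) x := fun i x =>
    Set.indicator_nonneg (fun y _ => gaussianPDFReal_nonneg 0 1 y) x
  rw [← ofReal_integral_eq_lintegral_ofReal]
  · rw [integral_fintype_prod_volume_eq_prod (f := fun i => (s i).indicator (gaussianPDFReal 0 1)),
      ENNReal.ofReal_prod_of_nonneg (fun i _ => integral_nonneg (hnn i))]
    refine Finset.prod_congr rfl fun i _ => ?_
    rw [gaussianReal_apply_eq_integral 0 (by simp), integral_indicator (hs i)]
  · exact Integrable.fintype_prod hint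
  · exact Filter.Eventually.of_forall fun z => Finset.prod_nonneg fun i _ => hnn i _

lemma P0_gaussian (d : ℕ) : IsGaussian (P0 d) := by
  have h : P0 d = (stdGaussian (EuclideanSpace ℝ (Fin d))).map
      (EuclideanSpace.equiv (Fin d) ℝ).toContinuousLinearMap := by
    rw [← map_pi_eq_stdGaussian, Measure.map_map (by fun_prop) (by fun_prop)]
    exact (Measure.map_id).symm
  rw [h]
  infer_instance

lemma exists_factor {d : ℕ} {Sg : Matrix (Fin d) (Fin d) ℝ} (hSg : Sg.PosDef) :
    ∃ A : Matrix (Fin d) (Fin d) ℝ, A * Aᵀ = Sg ∧ A.det ≠ 0 := by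
  open scoped MatrixOrder in
  have h := hSg.posSemidef.nonneg
  obtain ⟨B, hB⟩ := CStarAlgebra.nonneg_iff_eq_star_mul_self.mp h
  refine ⟨Bᵀ, ?_, ?_⟩
  · rw [hB, Matrix.transpose_transpose]; rfl
  · intro h0
    have := hSg.det_pos
    rw [hB, Matrix.det_mul] at this
    rw [Matrix.det_transpose] at h0
    simp [h0] at this

lemma dens_eq {d : ℕ} (μ : Fin d → ℝ) (A : Matrix (Fin d) (Fin d) ℝ) (hA : A.det ≠ 0)
    (z : Fin d → ℝ) :
    |A.det| * gpdf μ (A * Aᵀ) (μ + A *ᵥ z) = ∏ i, gaussianPDFReal 0 1 (z i) := by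
  have hu : IsUnit A.det := isUnit_iff_ne_zero.mpr hA
  have hut : IsUnit Aᵀ.det := by rwa [Matrix.det_transpose]
  have hq : (A *ᵥ z) ⬝ᵥ ((A * Aᵀ)⁻¹ *ᵥ (A *ᵥ z)) = ∑ i, z i ^ 2 := by
    rw [Matrix.mul_inv_rev, Matrix.mulVec_mulVec, Matrix.mul_assoc, Matrix.nonsing_inv_mul _ hu,
      Matrix.mul_one, ← Matrix.transpose_nonsing_inv, Matrix.mulVec_transpose, dotProduct_comm,
      ← Matrix.dotProduct_mulVec, Matrix.mulVec_mulVec, Matrix.nonsing_inv_mul _ hu,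
      Matrix.one_mulVec]
    simp [dotProduct, sq]
  unfold gpdf
  rw [add_sub_cancel_left, hq, Matrix.det_mul, Matrix.det_transpose]
  simp only [gaussianPDFReal, Finset.prod_mul_distrib, ← Real.exp_sum]
  rw [Real.sqrt_mul (by positivity), Real.sqrt_mul_self_eq_abs, mul_inv, ← mul_assoc]
  congr 1
  · have : |A.det| ≠ 0 := abs_ne_zero.mpr hA
    simp only [Finset.prod_const, Finset.card_univ, Fintype.card_fin, NNReal.coe_one, mul_one]
    rw [mul_comm, mul_assoc, inv_mul_cancel₀ this, mul_one, inv_pow]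
    congr 1
    rw [Real.sqrt_eq_iff_mul_self_eq (by positivity) (by positivity), ← mul_pow,
      Real.mul_self_sqrt (by positivity)]
  · congr 1
    rw [Finset.mul_sum]
    refine Finset.sum_congr rfl fun i _ => ?_
    simp; ring

lemma gauss_eq {d : ℕ} (μ : Fin d → ℝ) (A : Matrix (Fin d) (Fin d) ℝ) (hA : A.det ≠ 0) :
    gauss μ (A * Aᵀ) = (P0 d).map (fun z => μ + A *ᵥ z) := by
  have hu : IsUnit A.det := isUnit_iff_ne_zero.mpr hA
  have hc : Continuous (fun z : Fin d → ℝ => μ + A *ᵥ z) := by fun_prop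
  have hinj : Function.Injective (fun z : Fin d → ℝ => μ + A *ᵥ z) := by
    intro x y hxy
    have := add_left_cancel hxy
    exact Matrix.mulVec_injective_of_isUnit ((Matrix.isUnit_iff_isUnit_det A).mpr hu) this
  have hsurj : Function.Surjective (fun z : Fin d → ℝ => μ + A *ᵥ z) := by
    intro y
    refine ⟨A⁻¹ *ᵥ (y - μ), ?_⟩
    simp [Matrix.mulVec_mulVec, Matrix.mul_nonsing_inv _ hu]
  ext s hs
  rw [Measure.map_apply hc.measurable hs, P0_eq, gauss, withDensity_apply _ hs,
    withDensity_apply _ (hc.measurable hs)]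
  have hd : ∀ x ∈ (fun z : Fin d → ℝ => μ + A *ᵥ z) ⁻¹' s,
      HasFDerivWithinAt (fun z : Fin d → ℝ => μ + A *ᵥ z)
        (LinearMap.toContinuousLinearMap (Matrix.toLin' A)) ((fun z : Fin d → ℝ => μ + A *ᵥ z) ⁻¹' s) x := by
    intro x _
    exact ((LinearMap.toContinuousLinearMap (Matrix.toLin' A)).hasFDerivAt.const_add
      μ).hasFDerivWithinAt (s := (fun z : Fin d → ℝ => μ + A *ᵥ z) ⁻¹' s)
  conv_lhs => rw [← Set.image_preimage_eq s hsurj]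
  rw [lintegral_image_eq_lintegral_abs_det_fderiv_mul volume (hc.measurable hs) hd hinj.injOn]
  refine lintegral_congr fun z => ?_
  rw [← dens_eq μ A hA, ENNReal.ofReal_mul (abs_nonneg _)]
  congr 3
  simp [LinearMap.det_toContinuousLinearMap]

lemma gauss_gaussian {d : ℕ} (μ : Fin d → ℝ) {Sg : Matrix (Fin d) (Fin d) ℝ} (hSg : Sg.PosDef) :
    IsGaussian (gauss μ Sg) := by
  obtain ⟨A, rfl, hA⟩ := exists_factor hSg
  rw [gauss_eq μ A hA]
  have := P0_gaussian d
  have h : (P0 d).map (fun z => μ + A *ᵥ z) = ((P0 d).map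
      (LinearMap.toContinuousLinearMap (Matrix.toLin' A))).map (fun z => μ + z) := by
    rw [Measure.map_map (by fun_prop) (by fun_prop)]
    rfl
  rw [h]
  infer_instance

lemma var_P0 {d : ℕ} (c : Fin d → ℝ) : Var[fun z => c ⬝ᵥ z; P0 d] = c ⬝ᵥ c := by
  have h : (fun z : Fin d → ℝ => c ⬝ᵥ z) = ∑ i, fun z : Fin d → ℝ => (fun y => c i * y) (z i) := by
    ext z; simp [dotProduct]
  rw [h, P0, variance_sum_pi (X := fun i y => c i * y)]
  · simp only [dotProduct]
    refine Finset.sum_congr rfl fun i _ => ?_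
    rw [variance_const_mul]
    have : Var[fun y => y; gaussianReal 0 1] = 1 := by
      simpa using variance_fun_id_gaussianReal (μ := 0) (v := 1)
    rw [this]; ring
  · intro i
    exact (IsGaussian.memLp_two_fun_id (μ := gaussianReal 0 1)).const_mul (c i)

lemma gauss_map {d : ℕ} (μ : Fin d → ℝ) {Sg : Matrix (Fin d) (Fin d) ℝ} (hSg : Sg.PosDef)
    (r : Fin d → ℝ) : ∃ m, (gauss μ Sg).map (fun x => r ⬝ᵥ x) =
      gaussianReal m (r ⬝ᵥ (Sg *ᵥ r)).toNNReal := by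
  have hg := gauss_gaussian μ hSg
  obtain ⟨A, rfl, hA⟩ := exists_factor hSg
  let L : StrongDual ℝ (Fin d → ℝ) := LinearMap.toContinuousLinearMap
    (dotProductBilin ℝ ℝ r)
  have hL : (L : (Fin d → ℝ) → ℝ) = fun x => r ⬝ᵥ x := rfl
  have := IsGaussian.map_eq_gaussianReal (μ := gauss μ (A * Aᵀ)) L
  rw [hL] at this
  refine ⟨∫ x, r ⬝ᵥ x ∂(gauss μ (A * Aᵀ)), this.trans ?_⟩
  congr 2
  rw [gauss_eq μ A hA, variance_map (by fun_prop) (by fun_prop)]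
  have h2 : ((fun x => r ⬝ᵥ x) ∘ fun z => μ + A *ᵥ z) =
    fun z : Fin d → ℝ => r ⬝ᵥ μ + (Aᵀ *ᵥ r) ⬝ᵥ z := by
    ext z
    simp [dotProduct_add, Matrix.dotProduct_mulVec, Matrix.mulVec_transpose]
  rw [h2, variance_const_add (by fun_prop), var_P0, ← Matrix.mulVec_mulVec,
    Matrix.dotProduct_mulVec r, ← Matrix.mulVec_transpose]

lemma gaussianReal_strip (m : ℝ) (v : ℝ) (hv : 0 < v) (a t : ℝ) (ht : 0 ≤ t) :
    gaussianReal m v.toNNReal (Set.Icc (a - t) (a + t)) ≤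
      ENNReal.ofReal ((√(2 * π * v))⁻¹ * (2 * t)) := by
  have hv' : v.toNNReal ≠ 0 := by simpa using hv
  rw [gaussianReal_apply _ hv']
  calc _ ≤ ∫⁻ x in Set.Icc (a - t) (a + t), ENNReal.ofReal ((√(2 * π * v))⁻¹) := by
        refine lintegral_mono fun x => ?_
        rw [gaussianPDF]
        refine ENNReal.ofReal_le_ofReal ?_
        rw [gaussianPDFReal, Real.coe_toNNReal _ hv.le]
        refine mul_le_of_le_one_right (by positivity) ?_
        rw [Real.exp_le_one_iff]
        rw [neg_div]
        have : 0 ≤ (x - m) ^ 2 / (2 * v) := by positivity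
        linarith
    _ = _ := by
        rw [setLIntegral_const, Real.volume_Icc, ENNReal.ofReal_mul (by positivity)]
        congr 2; ring

lemma var_lower {d : ℕ} (P : Measure (Fin d → ℝ)) [IsProbabilityMeasure P] (f : (Fin d → ℝ) → ℝ)
    (hf : Measurable f) (m α v : ℝ) (h0 : 0 < α) (hv : 0 < v)
    (hint : Integrable (fun x => (f x - m) ^ 2) P)
    (hP : ∀ t, 0 ≤ t → P.real (f ⁻¹' Set.Icc (m - t) (m + t)) ≤
      (√(2 * π * v))⁻¹ * (2 * t) / α) :
    α ^ 2 / 12 * v ≤ ∫ x, (f x - m) ^ 2 ∂P := by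
  set s := √(2 * π * v) with hs
  have hspos : 0 < s := Real.sqrt_pos.mpr (by positivity)
  have hs2 : s ^ 2 = 2 * π * v := Real.sq_sqrt (by positivity)
  set t := α * s / 3 with ht
  have htp : 0 < t := by positivity
  have h1 := hP t htp.le
  have h2 : s⁻¹ * (2 * t) / α = 2 / 3 := by rw [ht]; field_simp
  rw [h2] at h1
  have hmk := mul_meas_ge_le_integral_of_nonneg (μ := P) (f := fun x => (f x - m) ^ 2)
    (Filter.Eventually.of_forall fun x => sq_nonneg _) hint (t ^ 2)
  have hsub : (f ⁻¹' Set.Icc (m - t) (m + t))ᶜ ⊆ {x | t ^ 2 ≤ (f x - m) ^ 2} := by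
    intro x hx
    simp only [Set.mem_compl_iff, Set.mem_preimage, Set.mem_Icc, not_and_or, not_le] at hx
    simp only [Set.mem_setOf_eq]
    rcases hx with hx | hx <;> nlinarith
  have h3 : 1 / 3 ≤ P.real {x | t ^ 2 ≤ (f x - m) ^ 2} := by
    refine le_trans ?_ (measureReal_mono hsub)
    rw [probReal_compl_eq_one_sub (hf measurableSet_Icc)]
    linarith
  have h4 : t ^ 2 * (1 / 3) ≤ ∫ x, (f x - m) ^ 2 ∂P :=
    le_trans (mul_le_mul_of_nonneg_left h3 (by positivity)) hmk
  refine le_trans ?_ h4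
  have : t ^ 2 = α ^ 2 * (2 * π * v) / 9 := by rw [ht, ← hs2]; ring
  rw [this]
  have hpi := Real.pi_gt_three
  have : 0 < α ^ 2 * v := by positivity
  nlinarith

lemma covm_quad {d : ℕ} (P : Measure (Fin d → ℝ)) [IsProbabilityMeasure P]
    (h2 : ∀ i, MemLp (fun x : Fin d → ℝ => x i) 2 P) (r : Fin d → ℝ) :
    r ⬝ᵥ (covm P *ᵥ r) = ∫ x, (r ⬝ᵥ x - r ⬝ᵥ meanv P) ^ 2 ∂P := by
  have hc : ∀ i, MemLp (fun x : Fin d → ℝ => x i - meanv P i) 2 P := fun i =>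
    (h2 i).sub (memLp_const _)
  have hij : ∀ i j, Integrable
      (fun x : Fin d → ℝ => (x i - meanv P i) * (x j - meanv P j)) P := fun i j =>
    (hc i).integrable_mul (hc j)
  have hexp : ∀ x : Fin d → ℝ, (r ⬝ᵥ x - r ⬝ᵥ meanv P) ^ 2 =
      ∑ i, ∑ j, r i * r j * ((x i - meanv P i) * (x j - meanv P j)) := by
    intro x
    rw [← dotProduct_sub, sq]
    simp only [dotProduct, Finset.sum_mul_sum, Pi.sub_apply]
    refine Finset.sum_congr rfl fun i _ => Finset.sum_congr rfl fun j _ => ?_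
    ring
  simp_rw [hexp]
  rw [integral_finsetSum _ fun i _ => integrable_finsetSum _ fun j _ => (hij i j).const_mul _]
  simp only [dotProduct, Matrix.mulVec, Finset.mul_sum]
  refine Finset.sum_congr rfl fun i _ => ?_
  rw [integral_finsetSum _ fun j _ => (hij i j).const_mul _]
  refine Finset.sum_congr rfl fun j _ => ?_
  rw [integral_const_mul]
  simp only [covm, Matrix.of_apply]
  ring

/-- If `N(μ,Σ;S) ≥ α` with `α ∈ (0,1]`, then the covariance matrix `Σ_S` of
the truncated normal `N(μ,Σ,S)` satisfies `Σ_S ⪰ (α²/12) Σ`. -/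
theorem statement11 {d : ℕ} (μ : Fin d → ℝ) (Sg : Matrix (Fin d) (Fin d) ℝ)
    (hSg : Sg.PosDef) (S : Set (Fin d → ℝ)) (hS : MeasurableSet S)
    (α : ℝ) (h0 : 0 < α) (h1 : α ≤ 1)
    (hmass : ENNReal.ofReal α ≤ gauss μ Sg S) :
    (covm (truncGauss μ Sg S) - (α ^ 2 / 12) • Sg).PosSemidef := by
  have hg := gauss_gaussian μ hSg
  have hne : gauss μ Sg S ≠ 0 := by
    have : 0 < ENNReal.ofReal α := by simpa using h0
    exact (this.trans_le hmass).ne'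
  haveI : IsProbabilityMeasure (truncGauss μ Sg S) := cond_isProbabilityMeasure hne
  have hmem : ∀ i, MemLp (fun x : Fin d → ℝ => x i) 2 (truncGauss μ Sg S) := by
    intro i
    have h := (ContinuousLinearMap.proj (R := ℝ) (φ := fun _ : Fin d => ℝ) i).comp_memLp'
      (IsGaussian.memLp_two_id (μ := gauss μ Sg))
    unfold truncGauss ProbabilityTheory.cond
    exact (h.restrict S).smul_measure (by simpa using hne)
  have hreal : α ≤ (gauss μ Sg).real S := by
    rw [measureReal_def]
    exact (ENNReal.ofReal_le_iff_le_toReal (measure_ne_top _ _)).mp hmass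
  refine Matrix.PosSemidef.of_dotProduct_mulVec_nonneg ?_ ?_
  · refine Matrix.IsHermitian.sub ?_ ?_
    · ext i j
      simp only [covm, Matrix.conjTranspose_apply, Matrix.of_apply, star_trivial]
      congr 1; ext x; ring
    · have := hSg.isHermitian
      ext i j
      have h := congrFun (congrFun this i) j
      simp only [Matrix.conjTranspose_apply, star_trivial] at h
      simp [h]
  · intro r
    rw [star_trivial, Matrix.sub_mulVec, dotProduct_sub, Matrix.smul_mulVec, dotProduct_smul,
      smul_eq_mul, sub_nonneg]
    by_cases hr : r = 0
    · simp [hr]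
    have hv : 0 < r ⬝ᵥ (Sg *ᵥ r) := by
      simpa using hSg.dotProduct_mulVec_pos hr
    rw [covm_quad _ hmem]
    refine var_lower _ (fun x => r ⬝ᵥ x) (by fun_prop) _ α _ h0 hv ?_ ?_
    · have h : MemLp (fun x : Fin d → ℝ => r ⬝ᵥ x) 2 (truncGauss μ Sg S) := by
        simp only [dotProduct]
        exact memLp_finsetSum _ fun i _ => (hmem i).const_mul (r i)
      exact (h.sub (memLp_const (r ⬝ᵥ meanv (truncGauss μ Sg S)))).integrable_sq
    · intro t ht
      set m := r ⬝ᵥ meanv (truncGauss μ Sg S)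
      have hmeas : Measurable (fun x : Fin d → ℝ => r ⬝ᵥ x) := by fun_prop
      obtain ⟨m', hm'⟩ := gauss_map μ hSg r
      have hb := gaussianReal_strip m' _ hv m t ht
      rw [← hm', Measure.map_apply hmeas measurableSet_Icc] at hb
      have hb' : (gauss μ Sg).real ((fun x => r ⬝ᵥ x) ⁻¹' Set.Icc (m - t) (m + t)) ≤
          (√(2 * π * (r ⬝ᵥ (Sg *ᵥ r))))⁻¹ * (2 * t) :=
        ENNReal.toReal_le_of_le_ofReal (by positivity) hb
      rw [truncGauss, measureReal_def, cond_apply hS, ENNReal.toReal_mul, ENNReal.toReal_inv,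
        ← measureReal_def, ← measureReal_def]
      rw [div_eq_inv_mul _ α]
      gcongr
      exact (measureReal_mono Set.inter_subset_right).trans hb'

end
end

section
/- There is a function c : (0,1] → (0,1] such that the following holds for every dimension d ≥ 1: if μ* ∈ ℝ^d, Σ* is symmetric positive definite, and S ⊆ ℝ^d is measurable with N(μ*,Σ*;S) ≥ α for some α ∈ (0,1], then the Gaussian whose parameters are the mean μ_S and covariance Σ_S of the truncated normal N(μ*,Σ*,S) itself assigns non-trivial mass to S: N(μ_S, Σ_S; S) ≥ c(α). -/
open MeasureTheory ProbabilityTheory Matrix Real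

noncomputable section

open scoped MatrixOrder in
lemma posSemidef_factor {d : ℕ} {A : Matrix (Fin d) (Fin d) ℝ} (hA : A.PosSemidef) :
    ∃ B : Matrix (Fin d) (Fin d) ℝ, A = Bᴴ * B := by
  obtain ⟨B, hB⟩ := CStarAlgebra.nonneg_iff_eq_star_mul_self.mp hA.nonneg
  exact ⟨B, hB⟩

lemma det_le_exp_trace {d : ℕ} (M : Matrix (Fin d) (Fin d) ℝ) (hM : M.PosSemidef) :
    M.det ≤ Real.exp (M.trace - d) := by
  rw [hM.1.det_eq_prod_eigenvalues, hM.1.trace_eq_sum_eigenvalues]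
  have : (∑ i, (hM.1.eigenvalues i : ℝ)) - d = ∑ i, (hM.1.eigenvalues i - 1) := by
    simp [Finset.sum_sub_distrib]
  simp only [RCLike.ofReal_real_eq_id, id]
  rw [this, Real.exp_sum]
  refine Finset.prod_le_prod (fun i _ => hM.eigenvalues_nonneg i) (fun i _ => ?_)
  have := Real.add_one_le_exp (hM.1.eigenvalues i - 1)
  linarith

lemma det_mul_le_exp_trace {d : ℕ} (A T : Matrix (Fin d) (Fin d) ℝ) (hA : A.PosSemidef)
    (hT : T.PosSemidef) : A.det * T.det ≤ Real.exp ((A * T).trace - d) := by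
  obtain ⟨B, rfl⟩ := posSemidef_factor hA
  have h := det_le_exp_trace (B * T * Bᴴ) (hT.mul_mul_conjTranspose_same B)
  rw [Matrix.trace_mul_cycle] at h
  calc _ = (B * T * Bᴴ).det := by simp only [Matrix.det_mul]; ring
    _ ≤ _ := h

lemma quad_lower {d : ℕ} (A : Matrix (Fin d) (Fin d) ℝ) (hA : A.PosDef) :
    ∃ m : ℝ, 0 < m ∧ ∀ x : Fin d → ℝ, m * ∑ i, x i ^ 2 ≤ x ⬝ᵥ (A *ᵥ x) := by
  obtain ⟨B, hB⟩ := posSemidef_factor hA.posSemidef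
  have hdet : IsUnit B.det := by
    have h := hA.det_pos
    rw [hB, Matrix.det_mul] at h
    exact isUnit_iff_ne_zero.mpr (fun h0 => by simp [h0] at h)
  set C := LinearMap.toContinuousLinearMap (Matrix.mulVecLin B⁻¹)
  refine ⟨((d + 1) * (‖C‖ ^ 2 + 1))⁻¹, by positivity, fun x => ?_⟩
  have hq : x ⬝ᵥ (A *ᵥ x) = ∑ i, (B *ᵥ x) i ^ 2 := by
    rw [hB, ← Matrix.mulVec_mulVec, Matrix.dotProduct_mulVec]
    simp only [Matrix.conjTranspose_eq_transpose_of_trivial, Matrix.vecMul_transpose, dotProduct, sq]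
  have h1 : ‖x‖ ≤ ‖C‖ * ‖B *ᵥ x‖ := by
    have := C.le_opNorm (B *ᵥ x)
    have e : C (B *ᵥ x) = x := by
      simp [C, Matrix.mulVec_mulVec, Matrix.nonsing_inv_mul _ hdet]
    rwa [e] at this
  have h2 : ‖B *ᵥ x‖ ^ 2 ≤ ∑ i, (B *ᵥ x) i ^ 2 := by
    have : ‖B *ᵥ x‖ ≤ Real.sqrt (∑ i, (B *ᵥ x) i ^ 2) := by
      refine (pi_norm_le_iff_of_nonneg (Real.sqrt_nonneg _)).mpr fun i => ?_
      refine Real.le_sqrt_of_sq_le ?_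
      rw [Real.norm_eq_abs, sq_abs]
      exact Finset.single_le_sum (f := fun i => (B *ᵥ x) i ^ 2) (fun _ _ => sq_nonneg _)
        (Finset.mem_univ i)
    calc _ ≤ Real.sqrt (∑ i, (B *ᵥ x) i ^ 2) ^ 2 := by gcongr
      _ = _ := Real.sq_sqrt (Finset.sum_nonneg fun _ _ => sq_nonneg _)
  have h3 : ∑ i, x i ^ 2 ≤ d * ‖x‖ ^ 2 := by
    calc ∑ i, x i ^ 2 ≤ ∑ _i : Fin d, ‖x‖ ^ 2 := by
          refine Finset.sum_le_sum fun i _ => ?_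
          rw [← sq_abs]
          have := norm_le_pi_norm x i
          rw [Real.norm_eq_abs] at this
          gcongr
      _ = _ := by simp
  rw [hq, inv_mul_le_iff₀ (by positivity)]
  calc ∑ i, x i ^ 2 ≤ d * ‖x‖ ^ 2 := h3
    _ ≤ d * (‖C‖ * ‖B *ᵥ x‖) ^ 2 := by gcongr
    _ = d * ‖C‖ ^ 2 * ‖B *ᵥ x‖ ^ 2 := by ring
    _ ≤ (d + 1) * (‖C‖ ^ 2 + 1) * ∑ i, (B *ᵥ x) i ^ 2 := by gcongr <;> simp

lemma gpdf_cont {d : ℕ} (μ : Fin d → ℝ) (Sg : Matrix (Fin d) (Fin d) ℝ) :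
    Continuous (gpdf μ Sg) := by
  unfold gpdf
  fun_prop

lemma gpdf_nonneg {d : ℕ} (μ : Fin d → ℝ) (Sg : Matrix (Fin d) (Fin d) ℝ) (x) :
    0 ≤ gpdf μ Sg x := by
  unfold gpdf
  positivity

lemma integrable_exp_sum {d : ℕ} (m : ℝ) (hm : 0 < m) :
    Integrable (fun x : Fin d → ℝ => Real.exp (-m * ∑ i, x i ^ 2)) := by
  have := MeasureTheory.Integrable.fintype_prod (ι := Fin d) (f := fun _ t => Real.exp (-m * t ^ 2))
    (μ := fun _ => (volume : Measure ℝ)) (fun _ => integrable_exp_neg_mul_sq hm)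
  refine this.congr (Filter.Eventually.of_forall fun x => ?_)
  simp only [Finset.mul_sum, Real.exp_sum]

lemma integrable_gpdf {d : ℕ} (μ : Fin d → ℝ) (Sg : Matrix (Fin d) (Fin d) ℝ) (hS : Sg.PosDef)
    (i : Fin d) :
    Integrable (fun x : Fin d → ℝ => (1 + (x i - μ i) ^ 2) * gpdf μ Sg x) := by
  obtain ⟨m, hm, hq⟩ := quad_lower Sg⁻¹ hS.inv
  set K := (Real.sqrt ((2 * Real.pi) ^ d * Sg.det))⁻¹ with hK
  have hK0 : 0 ≤ K := by positivity
  have h0 := ((integrable_exp_sum (d := d) (m / 4) (by positivity)).comp_sub_right μ).const_mul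
    (K * (1 + 4 / m))
  refine h0.mono' ?_ (Filter.Eventually.of_forall fun x => ?_)
  · exact (Continuous.mul (by fun_prop) (gpdf_cont μ Sg)).aestronglyMeasurable
  rw [Real.norm_of_nonneg (mul_nonneg (by positivity) (gpdf_nonneg _ _ _))]
  set s := ∑ j, (x - μ) j ^ 2 with hs
  have hs0 : (x i - μ i) ^ 2 ≤ s :=
    Finset.single_le_sum (f := fun j => (x - μ) j ^ 2) (fun _ _ => sq_nonneg _) (Finset.mem_univ i)
  have hs1 : 0 ≤ s := le_trans (sq_nonneg _) hs0
  have e1 : gpdf μ Sg x ≤ K * Real.exp (-(m / 2) * s) := by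
    unfold gpdf
    refine mul_le_mul_of_nonneg_left (Real.exp_le_exp.mpr ?_) hK0
    have := hq (x - μ)
    rw [← hs] at this
    linarith
  have e2 : 1 + s ≤ (1 + 4 / m) * Real.exp (m / 4 * s) := by
    have h1 := Real.add_one_le_exp (m / 4 * s)
    have h2 : 1 ≤ Real.exp (m / 4 * s) := Real.one_le_exp (by positivity)
    have h3 : s ≤ 4 / m * Real.exp (m / 4 * s) := by
      calc s = 4 / m * (m / 4 * s) := by field_simp
        _ ≤ _ := by gcongr; linarith
    linarith
  calc (1 + (x i - μ i) ^ 2) * gpdf μ Sg x ≤ (1 + s) * (K * Real.exp (-(m / 2) * s)) := by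
        gcongr
        exact gpdf_nonneg _ _ _
    _ ≤ ((1 + 4 / m) * Real.exp (m / 4 * s)) * (K * Real.exp (-(m / 2) * s)) := by gcongr
    _ = K * (1 + 4 / m) * (Real.exp (m / 4 * s) * Real.exp (-(m / 2) * s)) := by ring
    _ = _ := by rw [← Real.exp_add]; congr 2; ring

lemma integrable_gpdf' {d : ℕ} (μ : Fin d → ℝ) (Sg : Matrix (Fin d) (Fin d) ℝ) (hS : Sg.PosDef)
    (i : Fin d) : Integrable (gpdf μ Sg) := by
  refine (integrable_gpdf μ Sg hS i).mono' (gpdf_cont μ Sg).aestronglyMeasurable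
    (Filter.Eventually.of_forall fun x => ?_)
  rw [Real.norm_of_nonneg (gpdf_nonneg _ _ _)]
  have := gpdf_nonneg μ Sg x
  nlinarith [mul_nonneg (sq_nonneg (x i - μ i)) this]

lemma gauss_finite {d : ℕ} (hd : 1 ≤ d) (μ : Fin d → ℝ) (Sg : Matrix (Fin d) (Fin d) ℝ)
    (hS : Sg.PosDef) : IsFiniteMeasure (gauss μ Sg) :=
  isFiniteMeasure_withDensity_ofReal (integrable_gpdf' μ Sg hS ⟨0, hd⟩).2

lemma memLp_gauss {d : ℕ} (hd : 1 ≤ d) (μ : Fin d → ℝ) (Sg : Matrix (Fin d) (Fin d) ℝ)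
    (hS : Sg.PosDef) (i : Fin d) : MemLp (fun x : Fin d → ℝ => x i) 2 (gauss μ Sg) := by
  have := gauss_finite hd μ Sg hS
  have h : MemLp (fun x : Fin d → ℝ => x i - μ i) 2 (gauss μ Sg) := by
    rw [memLp_two_iff_integrable_sq (Measurable.aestronglyMeasurable (by fun_prop))]
    unfold gauss
    rw [integrable_withDensity_iff_integrable_smul' (gpdf_cont μ Sg).measurable.ennreal_ofReal
      (Filter.Eventually.of_forall fun x => ENNReal.ofReal_lt_top)]
    refine (integrable_gpdf μ Sg hS i).mono' ?_ (Filter.Eventually.of_forall fun x => ?_)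
    · have := (gpdf_cont μ Sg).measurable
      exact Measurable.aestronglyMeasurable (by fun_prop)
    have := gpdf_nonneg μ Sg x
    rw [ENNReal.toReal_ofReal this, smul_eq_mul, Real.norm_of_nonneg (by positivity)]
    nlinarith
  have h2 := h.add (memLp_const (μ i))
  have e : ((fun x : Fin d → ℝ => x i - μ i) + fun _ => μ i) = fun x => x i := by
    ext x; simp
  rwa [e] at h2

/-- Integrals of quadratic forms. -/
lemma integral_quad {d : ℕ} (P : Measure (Fin d → ℝ)) [IsProbabilityMeasure P]
    (hP : ∀ i, MemLp (fun x : Fin d → ℝ => x i) 2 P) (A : Matrix (Fin d) (Fin d) ℝ)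
    (c : Fin d → ℝ) :
    Integrable (fun x => (x - c) ⬝ᵥ (A *ᵥ (x - c))) P ∧
    ∫ x, (x - c) ⬝ᵥ (A *ᵥ (x - c)) ∂P =
      (A * covm P).trace + (meanv P - c) ⬝ᵥ (A *ᵥ (meanv P - c)) := by
  have hi : ∀ i, Integrable (fun x : Fin d → ℝ => x i) P := fun i =>
    (hP i).integrable (by norm_num)
  have hm : ∀ i j (a b : ℝ), Integrable (fun x : Fin d → ℝ => (x i - a) * (x j - b)) P :=
    fun i j a b => ((hP i).sub (memLp_const a)).integrable_mul ((hP j).sub (memLp_const b))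
  have hexp : ∀ y : Fin d → ℝ, y ⬝ᵥ (A *ᵥ y) = ∑ i, ∑ j, A i j * (y i * y j) := by
    intro y
    simp only [dotProduct, Matrix.mulVec, Finset.mul_sum]
    exact Finset.sum_congr rfl fun i _ => Finset.sum_congr rfl fun j _ => by ring
  have hone : ∀ i j, ∫ x, (x i - c i) * (x j - c j) ∂P
      = covm P i j + (meanv P i - c i) * (meanv P j - c j) := by
    intro i j
    have e : ∀ x : Fin d → ℝ, (x i - c i) * (x j - c j) =
        (x i - meanv P i) * (x j - meanv P j) + ((meanv P i - c i) * (x j - c j)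
          + (meanv P j - c j) * (x i - meanv P i)) := fun x => by ring
    have s1 : ∀ i a, Integrable (fun x : Fin d → ℝ => x i - a) P :=
      fun i a => (hi i).sub (integrable_const a)
    have s2 : ∀ i a, ∫ x, (x i - a) ∂P = meanv P i - a := fun i a => by
      rw [integral_sub (hi i) (integrable_const a)]
      simp [meanv]
    have s3 : Integrable (fun x : Fin d → ℝ => (meanv P i - c i) * (x j - c j)
          + (meanv P j - c j) * (x i - meanv P i)) P :=
      ((s1 j _).const_mul _).add ((s1 i _).const_mul _)
    rw [integral_congr_ae (Filter.Eventually.of_forall e)]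
    rw [integral_add (hm i j _ _) s3,
      integral_add ((s1 j _).const_mul _) ((s1 i _).const_mul _), integral_const_mul,
      integral_const_mul, s2, s2]
    simp [covm]
  have hsym : ∀ i j, covm P i j = covm P j i := fun i j => by
    simp only [covm, Matrix.of_apply]
    exact integral_congr_ae (Filter.Eventually.of_forall fun x => mul_comm _ _)
  simp_rw [hexp]
  simp only [Pi.sub_apply]
  refine ⟨integrable_finsetSum _ fun i _ => integrable_finsetSum _ fun j _ =>
    (hm i j _ _).const_mul _, ?_⟩
  rw [integral_finsetSum _ fun i _ => integrable_finsetSum _ fun j _ =>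
    (hm i j (c i) (c j)).const_mul (A i j)]
  simp only [Matrix.trace, Matrix.diag_apply, Matrix.mul_apply, ← Finset.sum_add_distrib]
  refine Finset.sum_congr rfl fun i _ => ?_
  rw [integral_finsetSum _ fun j _ => (hm i j (c i) (c j)).const_mul (A i j)]
  refine Finset.sum_congr rfl fun j _ => ?_
  rw [integral_const_mul, hone, hsym i j]
  ring

lemma covm_posDef {d : ℕ} (P : Measure (Fin d → ℝ)) [IsProbabilityMeasure P]
    (hP : ∀ i, MemLp (fun x : Fin d → ℝ => x i) 2 P) (hac : P ≪ volume) : (covm P).PosDef := by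
  have hsym : (covm P).IsHermitian := by
    ext i j
    simp only [covm, Matrix.conjTranspose_apply, Matrix.of_apply, star_trivial]
    exact integral_congr_ae (Filter.Eventually.of_forall fun x => mul_comm _ _)
  refine Matrix.PosDef.of_dotProduct_mulVec_pos hsym fun v hv => ?_
  obtain ⟨hint, heq⟩ := integral_quad P hP (Matrix.vecMulVec v v) (meanv P)
  have hq : ∀ y : Fin d → ℝ, y ⬝ᵥ (Matrix.vecMulVec v v *ᵥ y) = (v ⬝ᵥ y) ^ 2 := by
    intro y
    rw [Matrix.vecMulVec_mulVec]
    simp [dotProduct_comm y v, sq]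
  have htr : (Matrix.vecMulVec v v * covm P).trace = v ⬝ᵥ (covm P *ᵥ v) := by
    rw [Matrix.trace_mul_comm, Matrix.mul_vecMulVec, Matrix.trace_vecMulVec, dotProduct_comm]
  simp_rw [hq] at hint heq
  rw [htr, sub_self, dotProduct_zero, zero_pow two_ne_zero, add_zero] at heq
  rw [star_trivial, ← heq]
  have hnn : 0 ≤ ∫ x, (v ⬝ᵥ (x - meanv P)) ^ 2 ∂P := integral_nonneg fun x => sq_nonneg _
  refine lt_of_le_of_ne hnn fun h0 => ?_
  have hae := (integral_eq_zero_iff_of_nonneg (fun x => sq_nonneg _) hint).mp h0.symm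
  -- the hyperplane is null
  have hnull : volume {x : Fin d → ℝ | v ⬝ᵥ (x - meanv P) = 0} = 0 := by
    let φ : (Fin d → ℝ) →ₗ[ℝ] ℝ := dotProductBilin ℝ ℝ v
    have hφ : ∀ x, φ x = v ⬝ᵥ x := fun x => rfl
    have hker : φ.ker ≠ ⊤ := fun h => hv (by
      have : φ v = 0 := by rw [LinearMap.ker_eq_top.mp h]; rfl
      rw [hφ] at this
      exact dotProduct_self_eq_zero.mp this)
    have h := MeasureTheory.Measure.addHaar_submodule volume φ.ker hker
    have e : {x : Fin d → ℝ | v ⬝ᵥ (x - meanv P) = 0} = (fun x => x - meanv P) ⁻¹' (φ.ker : Set _) := by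
      ext x; simp [hφ]
    rw [e]
    simpa [sub_eq_add_neg] using h
  have h1 : ∀ᵐ x ∂P, ¬ (v ⬝ᵥ (x - meanv P) = 0) := by
    rw [ae_iff]; simpa using hac hnull
  obtain ⟨x, hx1, hx2⟩ := (hae.and h1).exists
  exact hx2 (by simpa using hx1)

/-- There is a function `c : (0,1] → (0,1]` such that for every `d ≥ 1`:
if `N(μ*,Σ*;S) ≥ α` with `α ∈ (0,1]`, then the Gaussian whose parameters are the mean `μ_S`
and covariance `Σ_S` of the truncated normal `N(μ*,Σ*,S)` assigns mass at least `c(α)`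
to `S`. -/
theorem statement16 :
    ∃ c : ℝ → ℝ, (∀ α : ℝ, 0 < α → α ≤ 1 → 0 < c α ∧ c α ≤ 1) ∧
      ∀ d : ℕ, 1 ≤ d →
      ∀ (μstar : Fin d → ℝ) (Sgstar : Matrix (Fin d) (Fin d) ℝ), Sgstar.PosDef →
      ∀ S : Set (Fin d → ℝ), MeasurableSet S →
      ∀ α : ℝ, 0 < α → α ≤ 1 → ENNReal.ofReal α ≤ gauss μstar Sgstar S →
        ENNReal.ofReal (c α) ≤
          gauss (meanv (truncGauss μstar Sgstar S)) (covm (truncGauss μstar Sgstar S)) S := by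
  refine ⟨fun α => α, fun α h0 h1 => ⟨h0, h1⟩, ?_⟩
  intro d hd μ Sg hSg S hS α hα hα1 hαS
  refine hαS.trans ?_
  have := gauss_finite hd μ Sg hSg
  set G := gauss μ Sg with hG
  have hGS : G S ≠ 0 := fun h => by
    rw [h] at hαS
    simp only [nonpos_iff_eq_zero, ENNReal.ofReal_eq_zero] at hαS
    linarith
  have hGS' : G S ≠ ⊤ := measure_ne_top _ _
  set P := truncGauss μ Sg S with hPdef
  have hPeq : P = (G S)⁻¹ • G.restrict S := rfl
  have : IsProbabilityMeasure P := cond_isProbabilityMeasure hGS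
  have hP : ∀ i, MemLp (fun x : Fin d → ℝ => x i) 2 P := fun i => by
    rw [hPeq]
    exact ((memLp_gauss hd μ Sg hSg i).restrict S).smul_measure (ENNReal.inv_ne_top.mpr hGS)
  have hac : P ≪ volume :=
    (cond_absolutelyContinuous).trans (withDensity_absolutelyContinuous _ _)
  have hT := covm_posDef P hP hac
  set T := covm P with hTdef
  set ν := meanv P with hν
  obtain ⟨i1, e1⟩ := integral_quad P hP Sg⁻¹ μ
  obtain ⟨i2, e2⟩ := integral_quad P hP T⁻¹ ν
  have hTd := hT.det_pos
  have hSd := hSg.det_pos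
  rw [← hTdef, Matrix.nonsing_inv_mul _ (isUnit_iff_ne_zero.mpr hTd.ne'), ← hν, sub_self,
    zero_dotProduct, add_zero, Matrix.trace_one, Fintype.card_fin] at e2
  set g : (Fin d → ℝ) → ℝ := fun x => 1 / 2 * ((x - μ) ⬝ᵥ (Sg⁻¹ *ᵥ (x - μ)))
    - 1 / 2 * ((x - ν) ⬝ᵥ (T⁻¹ *ᵥ (x - ν))) with hg
  have hgi : Integrable g P := (i1.const_mul _).sub (i2.const_mul _)
  set m := ∫ x, g x ∂P with hm
  have hmge : 1 / 2 * ((Sg⁻¹ * T).trace - d) ≤ m := by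
    have h0 : 0 ≤ (ν - μ) ⬝ᵥ (Sg⁻¹ *ᵥ (ν - μ)) := by
      simpa using hSg.inv.posSemidef.dotProduct_mulVec_nonneg (ν - μ)
    rw [hm, hg, integral_sub (i1.const_mul _) (i2.const_mul _), integral_const_mul,
      integral_const_mul, e1, e2]
    linarith
  set r : ℝ := Real.sqrt ((2 * Real.pi) ^ d * Sg.det) with hr
  set t : ℝ := Real.sqrt ((2 * Real.pi) ^ d * T.det) with ht
  have hr0 : 0 < r := Real.sqrt_pos.mpr (by positivity)
  have ht0 : 0 < t := Real.sqrt_pos.mpr (by positivity)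
  have htr : t ≤ r * Real.exp m := by
    have h1 := det_mul_le_exp_trace Sg⁻¹ T hSg.inv.posSemidef hT.posSemidef
    have h2 : T.det ≤ Sg.det * Real.exp (2 * m) := by
      rw [Matrix.det_nonsing_inv, Ring.inverse_eq_inv', inv_mul_le_iff₀ hSd] at h1
      refine h1.trans ?_
      gcongr
      linarith
    rw [ht, Real.sqrt_le_left (by positivity), mul_pow r, hr, Real.sq_sqrt (by positivity),
      ← Real.exp_nat_mul, mul_assoc]
    gcongr
    exact_mod_cast h2
  have hpoint : ∀ x, gpdf μ Sg x * (1 + (g x - m)) ≤ gpdf ν T x := by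
    intro x
    have hx : gpdf ν T x = gpdf μ Sg x * (r / t * Real.exp (g x)) := by
      unfold gpdf
      rw [← hr, ← ht]
      have : Real.exp (-(1 / 2) * ((x - ν) ⬝ᵥ (T⁻¹ *ᵥ (x - ν)))) =
          Real.exp (-(1 / 2) * ((x - μ) ⬝ᵥ (Sg⁻¹ *ᵥ (x - μ)))) * Real.exp (g x) := by
        rw [← Real.exp_add, hg]; congr 1; ring
      rw [this]
      field_simp
    rw [hx]
    refine mul_le_mul_of_nonneg_left ?_ (gpdf_nonneg _ _ _)
    calc 1 + (g x - m) ≤ Real.exp (g x - m) := by linarith [Real.add_one_le_exp (g x - m)]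
      _ = t / t * Real.exp (g x - m) := by rw [div_self ht0.ne', one_mul]
      _ ≤ r * Real.exp m / t * Real.exp (g x - m) := by gcongr
      _ = r / t * (Real.exp m * Real.exp (g x - m)) := by ring
      _ = _ := by rw [← Real.exp_add]; congr 2; ring
  have hgm : Integrable (fun x => 1 + (g x - m)) P :=
    (integrable_const _).add (hgi.sub (integrable_const _))
  have hmean : ∫ x, (1 + (g x - m)) ∂P = 1 := by
    have hs : Integrable (fun x => g x - m) P := hgi.sub (integrable_const _)
    rw [integral_add (integrable_const _) hs,
      integral_sub hgi (integrable_const _)]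
    simp [← hm]
  have hgmeas : Measurable g := by
    have : Continuous g := by rw [hg]; fun_prop
    exact this.measurable
  have hlow : 1 ≤ ∫⁻ x, ENNReal.ofReal (1 + (g x - m)) ∂P := by
    have h := integral_eq_lintegral_pos_part_sub_lintegral_neg_part hgm
    rw [hmean] at h
    have h2 : 1 ≤ (∫⁻ x, ENNReal.ofReal (1 + (g x - m)) ∂P).toReal := by
      have := ENNReal.toReal_nonneg (a := ∫⁻ x, ENNReal.ofReal (-(1 + (g x - m))) ∂P)
      linarith
    by_contra hlt
    push Not at hlt
    have := (ENNReal.toReal_lt_toReal hlt.ne_top ENNReal.one_ne_top).mpr hlt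
    simp at this
    linarith
  have hlint : ∫⁻ x, ENNReal.ofReal (1 + (g x - m)) ∂P =
      (G S)⁻¹ * ∫⁻ x in S, ENNReal.ofReal (gpdf μ Sg x) * ENNReal.ofReal (1 + (g x - m)) := by
    rw [hPeq, lintegral_smul_measure, hG]
    unfold gauss
    rw [restrict_withDensity hS, lintegral_withDensity_eq_lintegral_mul _
      (gpdf_cont μ Sg).measurable.ennreal_ofReal (by fun_prop)]
    rfl
  have hfin : ∫⁻ x in S, ENNReal.ofReal (gpdf μ Sg x) * ENNReal.ofReal (1 + (g x - m)) ≤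
      gauss ν T S := by
    unfold gauss
    rw [withDensity_apply _ hS]
    refine lintegral_mono fun x => ?_
    rw [← ENNReal.ofReal_mul (gpdf_nonneg _ _ _)]
    exact ENNReal.ofReal_le_ofReal (hpoint x)
  calc G S = G S * 1 := (mul_one _).symm
    _ ≤ G S * ((G S)⁻¹ * ∫⁻ x in S, ENNReal.ofReal (gpdf μ Sg x) *
        ENNReal.ofReal (1 + (g x - m))) := by rw [← hlint]; gcongr
    _ = ∫⁻ x in S, ENNReal.ofReal (gpdf μ Sg x) * ENNReal.ofReal (1 + (g x - m)) := by
        rw [← mul_assoc, ENNReal.mul_inv_cancel hGS hGS', one_mul]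
    _ ≤ _ := hfin

end
end

section
/- Let r ≥ 1, β ∈ (0,1], and let (ν,T) and (ν*,T*) be pairs with ν, ν* ∈ ℝ^d and T, T* symmetric positive definite, each satisfying the constraints ‖ν‖₂ ≤ r, ‖I − T‖_F ≤ r, and ‖T⁻¹‖₂ ≤ r (and likewise for (ν*,T*)). Set μ = T⁻¹ν, Σ = T⁻¹, μ* = T*⁻¹ν*, Σ* = T*⁻¹, and let S ⊆ ℝ^d be measurable with N(μ,Σ;S) ≥ β and N(μ*,Σ*;S) ≥ β. Then E_{x ∼ N(μ*,Σ*,S)} E_{y ∼ N(μ,Σ,S)} ‖t(x) − t(y)‖₂² ≤ 100 · d² · r⁸ / β. -/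
open MeasureTheory ProbabilityTheory Matrix Real

noncomputable section

/-- Spectral norm (ℓ²-operator norm) of a `d × d` real matrix. -/
def specNorm {d : ℕ} (A : Matrix (Fin d) (Fin d) ℝ) : ℝ :=
  ‖Matrix.toEuclideanCLM (𝕜 := ℝ) A‖

/-- Squared Euclidean norm of `t(x) − t(y)` where `t(z) = ((−(1/2) z zᵀ)^♭, z)`:
`‖t(x)−t(y)‖₂² = ‖(−1/2)xxᵀ − (−1/2)yyᵀ‖_F² + ‖x−y‖₂²`. -/
def tDistSq {d : ℕ} (x y : Fin d → ℝ) : ℝ :=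
  fnorm ((-(1 / 2) : ℝ) • vecMulVec x x - (-(1 / 2) : ℝ) • vecMulVec y y) ^ 2 +
    vnorm (x - y) ^ 2

lemma s17_m4_int : Integrable (fun x : ℝ => x ^ 4) (gaussianReal 0 1) := by
  have h := memLp_id_gaussianReal (μ := 0) (v := 1) 4
  have h2 := h.integrable_norm_pow (by norm_num)
  refine h2.congr (ae_of_all _ fun x => ?_)
  simp only [id, Real.norm_eq_abs]
  exact Even.pow_abs (by decide) x

lemma s17_m4 : ∫ x, x ^ 4 ∂(gaussianReal 0 1) = 3 := by
  rw [integral_gaussianReal_eq_integral_smul one_ne_zero]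
  have h1 : ∀ x : ℝ, gaussianPDFReal 0 1 x • x ^ 4 =
      (√(2 * π))⁻¹ * (fun y : ℝ => y ^ (4:ℝ) * rexp (-(1/2) * y ^ (2:ℝ))) |x| := by
    intro x
    have e4 : |x| ^ (4:ℝ) = x ^ 4 := by
      rw [show (4:ℝ) = ((4:ℕ):ℝ) by norm_num, Real.rpow_natCast]
      exact Even.pow_abs (by decide) x
    have e2 : |x| ^ (2:ℝ) = x ^ 2 := by
      rw [show (2:ℝ) = ((2:ℕ):ℝ) by norm_num, Real.rpow_natCast]
      exact Even.pow_abs (by decide) x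
    simp only [gaussianPDFReal_def, e4, e2, smul_eq_mul]
    norm_num
    rw [show -x ^ 2 / 2 = -(1/2 * x ^ 2) by ring]
    ring
  rw [integral_congr_ae (ae_of_all _ h1), integral_const_mul,
    integral_comp_abs (f := fun y : ℝ => y ^ (4:ℝ) * rexp (-(1/2) * y ^ (2:ℝ))),
    integral_rpow_mul_exp_neg_mul_rpow (by norm_num) (by norm_num) (by norm_num)]
  have g : Real.Gamma ((4 + 1) / 2) = 3 / 4 * √π := by
    rw [show ((4:ℝ) + 1) / 2 = (1/2 + 1) + 1 by norm_num, Real.Gamma_add_one (by norm_num),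
      Real.Gamma_add_one (by norm_num), Real.Gamma_one_half_eq]
    ring
  have p : ((1:ℝ)/2) ^ (-((4:ℝ) + 1) / 2) = 4 * √2 := by
    rw [one_div, Real.inv_rpow (by norm_num), ← Real.rpow_neg (by norm_num),
      show -(-((4:ℝ) + 1) / 2) = ((2:ℕ):ℝ) + 1/2 by norm_num, Real.rpow_add (by norm_num),
      Real.rpow_natCast, ← Real.sqrt_eq_rpow]
    norm_num
  rw [g, p, Real.sqrt_mul (by norm_num)]
  have a : √2 ≠ 0 := by positivity
  have b : √π ≠ 0 := by positivity
  field_simp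

lemma s17_pi (d : ℕ) : (volume : Measure (Fin d → ℝ)).withDensity
      (fun z => ENNReal.ofReal (∏ i, gaussianPDFReal 0 1 (z i))) =
    Measure.pi (fun _ : Fin d => gaussianReal 0 1) := by
  symm
  apply Measure.pi_eq
  intro s hs
  rw [withDensity_apply _ (MeasurableSet.univ_pi hs), volume_pi, Measure.restrict_pi_pi,
    ← ofReal_integral_eq_lintegral_ofReal, integral_fintype_prod_eq_prod,
    ENNReal.ofReal_prod_of_nonneg]
  · refine Finset.prod_congr rfl fun i _ => ?_
    rw [gaussianReal_apply_eq_integral _ one_ne_zero]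
  · intro i _
    exact integral_nonneg fun x => gaussianPDFReal_nonneg _ _ _
  · exact Integrable.fintype_prod fun i => (integrable_gaussianPDFReal 0 1).restrict
  · exact ae_of_all _ fun z => Finset.prod_nonneg fun i _ => gaussianPDFReal_nonneg _ _ _

lemma s17_pi_m4_int (d : ℕ) : Integrable (fun z : Fin d → ℝ => (d : ℝ) * ∑ i, z i ^ 4)
    (Measure.pi (fun _ : Fin d => gaussianReal 0 1)) := by
  refine Integrable.const_mul (integrable_finsetSum _ fun i _ => ?_) _
  exact integrable_comp_eval (μ := fun _ : Fin d => gaussianReal 0 1) (i := i)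
    (f := fun x : ℝ => x ^ 4) s17_m4_int

lemma s17_pi_m4 (d : ℕ) : ∫ z : Fin d → ℝ, (d : ℝ) * ∑ i, z i ^ 4
    ∂(Measure.pi (fun _ : Fin d => gaussianReal 0 1)) = 3 * d ^ 2 := by
  rw [integral_const_mul, integral_finsetSum]
  · have : ∀ i : Fin d, ∫ z : Fin d → ℝ, z i ^ 4
        ∂(Measure.pi (fun _ : Fin d => gaussianReal 0 1)) = 3 := by
      intro i
      have h := (measurePreserving_eval (fun _ : Fin d => gaussianReal 0 1) i)
      have h2 := integral_map (μ := Measure.pi (fun _ : Fin d => gaussianReal 0 1))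
        h.measurable.aemeasurable (f := fun x : ℝ => x ^ 4) (by fun_prop)
      rw [h.map_eq, s17_m4] at h2
      exact h2.symm
    simp [this]
    ring
  · intro i _
    exact integrable_comp_eval (μ := fun _ : Fin d => gaussianReal 0 1) (i := i)
      (f := fun x : ℝ => x ^ 4) s17_m4_int

lemma s17_fact {d : ℕ} {T : Matrix (Fin d) (Fin d) ℝ} (hT : T.PosDef) :
    ∃ B : Matrix (Fin d) (Fin d) ℝ, B.det ≠ 0 ∧ T = Bᵀ * B := by
  open scoped MatrixOrder Matrix.Norms.L2Operator in
  obtain ⟨B, hB⟩ := CStarAlgebra.nonneg_iff_eq_star_mul_self.mp hT.posSemidef.nonneg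
  refine ⟨B, ?_, by simpa [Matrix.star_eq_conjTranspose] using hB⟩
  intro h
  have := hT.det_pos
  rw [hB, det_mul, h] at this
  simp at this

lemma s17_gpdf {d : ℕ} (μ : Fin d → ℝ) (B : Matrix (Fin d) (Fin d) ℝ) (hB : B.det ≠ 0)
    (x : Fin d → ℝ) :
    gpdf μ (Bᵀ * B)⁻¹ x = |B.det| * ∏ i, gaussianPDFReal 0 1 ((B *ᵥ (x - μ)) i) := by
  have hdet : (Bᵀ * B).det = B.det ^ 2 := by rw [det_mul, det_transpose]; ring
  have hu : IsUnit (Bᵀ * B).det := by rw [hdet]; exact (pow_ne_zero 2 hB).isUnit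
  have hq : (x - μ) ⬝ᵥ ((Bᵀ * B) *ᵥ (x - μ)) = ∑ i, (B *ᵥ (x - μ)) i ^ 2 := by
    rw [← mulVec_mulVec, dotProduct_mulVec, vecMul_transpose]
    simp [dotProduct, sq]
  unfold gpdf
  rw [nonsing_inv_nonsing_inv _ hu, hq, det_nonsing_inv, hdet, Ring.inverse_eq_inv]
  simp only [gaussianPDFReal_def]
  rw [Finset.prod_mul_distrib, ← Real.exp_sum, Finset.prod_const, Finset.card_univ,
    Fintype.card_fin, ← mul_assoc]
  congr 1
  · rw [Real.sqrt_mul (by positivity), Real.sqrt_inv, Real.sqrt_sq_eq_abs, mul_inv, inv_inv,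
      mul_comm, inv_pow]
    congr 2
    rw [Real.sqrt_eq_iff_mul_self_eq (by positivity) (by positivity), ← mul_pow,
      Real.mul_self_sqrt (by positivity)]
    simp
  · congr 1
    rw [Finset.mul_sum]
    refine Finset.sum_congr rfl fun i _ => ?_
    simp
    ring

lemma s17_map {d : ℕ} (μ : Fin d → ℝ) (B : Matrix (Fin d) (Fin d) ℝ) (hB : B.det ≠ 0) :
    (gauss μ (Bᵀ * B)⁻¹).map (fun x => B *ᵥ (x - μ)) =
      Measure.pi (fun _ : Fin d => gaussianReal 0 1) := by
  have hm : Measurable (fun x : Fin d → ℝ => B *ᵥ (x - μ)) := by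
    apply Continuous.measurable
    fun_prop
  have hv : (volume : Measure (Fin d → ℝ)).map (fun x => B *ᵥ (x - μ)) =
      ENNReal.ofReal (|B.det⁻¹|) • volume := by
    have h1 := Real.map_matrix_volume_pi_eq_smul_volume_pi hB
    have h2 := (measurePreserving_sub_right (volume : Measure (Fin d → ℝ)) μ)
    rw [← h1]
    conv_rhs => rw [← h2.map_eq]
    rw [Measure.map_map _ h2.measurable]
    · rfl
    · exact (LinearMap.continuous_of_finiteDimensional _).measurable
  rw [← s17_pi]
  have hp : Measurable (fun z : Fin d → ℝ =>
      ENNReal.ofReal (∏ i, gaussianPDFReal 0 1 (z i))) := by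
    have := measurable_gaussianPDFReal 0 1
    fun_prop
  ext s hs
  rw [Measure.map_apply hm hs, gauss, withDensity_apply _ (hm hs), withDensity_apply _ hs]
  have hd : ∀ x, ENNReal.ofReal (gpdf μ (Bᵀ * B)⁻¹ x) = ENNReal.ofReal |B.det| *
      (fun z : Fin d → ℝ => ENNReal.ofReal (∏ i, gaussianPDFReal 0 1 (z i))) (B *ᵥ (x - μ)) := by
    intro x
    rw [s17_gpdf μ B hB, ENNReal.ofReal_mul (abs_nonneg _)]
  rw [lintegral_congr hd, lintegral_const_mul' _ _ ENNReal.ofReal_ne_top, ← setLIntegral_map hs hp hm, hv, Measure.restrict_smul,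
    lintegral_smul_measure, smul_eq_mul, ← mul_assoc, ← ENNReal.ofReal_mul (abs_nonneg _),
    ← abs_mul, mul_inv_cancel₀ hB]
  simp

lemma s17_sq_norm {d : ℕ} (x : Fin d → ℝ) : ‖WithLp.toLp 2 x‖ ^ 2 = ∑ i, x i ^ 2 := by
  rw [EuclideanSpace.norm_sq_eq]
  simp

lemma s17_inv {d : ℕ} {r : ℝ} (B : Matrix (Fin d) (Fin d) ℝ) (hB : B.det ≠ 0)
    (h : specNorm (Bᵀ * B)⁻¹ ≤ r) (x : Fin d → ℝ) :
    ∑ i, x i ^ 2 ≤ r * ∑ i, (B *ᵥ x) i ^ 2 := by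
  open scoped Matrix.Norms.L2Operator in
  have hn : ‖B⁻¹‖ * ‖B⁻¹‖ ≤ r := by
    rw [← l2_opNorm_conjTranspose B⁻¹, ← l2_opNorm_conjTranspose_mul_self]
    refine le_trans (le_of_eq ?_) h
    rw [specNorm, l2_opNorm_toEuclideanCLM, Matrix.mul_inv_rev]
    simp [Matrix.transpose_nonsing_inv]
  have h2 := l2_opNorm_mulVec B⁻¹ (WithLp.toLp 2 (B *ᵥ x))
  simp only [mulVec_mulVec, nonsing_inv_mul B hB.isUnit, one_mulVec] at h2
  rw [← s17_sq_norm, ← s17_sq_norm]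
  calc ‖WithLp.toLp 2 x‖ ^ 2 ≤ (‖B⁻¹‖ * ‖WithLp.toLp 2 (B *ᵥ x)‖) ^ 2 := by
        gcongr
        exact h2
    _ = (‖B⁻¹‖ * ‖B⁻¹‖) * ‖WithLp.toLp 2 (B *ᵥ x)‖ ^ 2 := by ring
    _ ≤ _ := by gcongr

lemma s17_mean {d : ℕ} {r : ℝ} (hr : 0 ≤ r) (A : Matrix (Fin d) (Fin d) ℝ)
    (h : specNorm A ≤ r) (ν : Fin d → ℝ) (hν : vnorm ν ≤ r) :
    ∑ i, (A *ᵥ ν) i ^ 2 ≤ r ^ 4 := by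
  have h2 := (Matrix.toEuclideanCLM (𝕜 := ℝ) A).le_opNorm (WithLp.toLp 2 ν)
  rw [toEuclideanCLM_toLp] at h2
  have h3 : ‖WithLp.toLp 2 ν‖ = vnorm ν := by
    rw [vnorm, ← s17_sq_norm, Real.sqrt_sq (norm_nonneg _)]
  rw [← s17_sq_norm]
  have h4 : ‖WithLp.toLp 2 (A *ᵥ ν)‖ ≤ r * r :=
    h2.trans (mul_le_mul h (h3 ▸ hν) (norm_nonneg _) hr)
  calc _ ≤ (r * r) ^ 2 := by gcongr
    _ = r ^ 4 := by ring

/-- main bound for one truncated Gaussian -/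
lemma s17_trunc {d : ℕ} (r β : ℝ) (hr : 1 ≤ r) (hβ0 : 0 < β)
    (ν : Fin d → ℝ) (T : Matrix (Fin d) (Fin d) ℝ)
    (hT : T.PosDef) (hν : vnorm ν ≤ r) (hTinv : specNorm T⁻¹ ≤ r)
    (S : Set (Fin d → ℝ))
    (hmass : ENNReal.ofReal β ≤ gauss (T⁻¹ *ᵥ ν) T⁻¹ S) :
    IsProbabilityMeasure (truncGauss (T⁻¹ *ᵥ ν) T⁻¹ S) ∧
    Integrable (fun x : Fin d → ℝ => (∑ i, x i ^ 2) ^ 2) (truncGauss (T⁻¹ *ᵥ ν) T⁻¹ S) ∧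
    ∫ x, (∑ i, x i ^ 2) ^ 2 ∂(truncGauss (T⁻¹ *ᵥ ν) T⁻¹ S) ≤
      (8 * r ^ 8 + 24 * d ^ 2 * r ^ 2) / β := by
  have hμ := s17_mean (by linarith) T⁻¹ hTinv ν hν
  obtain ⟨B, hB, rfl⟩ := s17_fact hT
  set μ := (Bᵀ * B)⁻¹ *ᵥ ν with hμdef
  set G := gauss μ (Bᵀ * B)⁻¹ with hG
  have hm : Measurable (fun x : Fin d → ℝ => B *ᵥ (x - μ)) := by
    apply Continuous.measurable
    fun_prop
  have hmap : G.map (fun x => B *ᵥ (x - μ)) = _ := s17_map μ B hB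
  have hP : IsProbabilityMeasure G := by
    constructor
    have : G.map (fun x => B *ᵥ (x - μ)) Set.univ = 1 := by rw [hmap]; exact measure_univ
    rwa [Measure.map_apply hm MeasurableSet.univ, Set.preimage_univ] at this
  have hS0 : G S ≠ 0 := by
    have : 0 < ENNReal.ofReal β := by simpa using hβ0
    exact (this.trans_le hmass).ne'
  have hβS : β ≤ (G S).toReal := by
    rwa [← ENNReal.ofReal_le_iff_le_toReal (measure_ne_top _ _)]
  -- pointwise bound
  have hpt : ∀ x : Fin d → ℝ, (∑ i, x i ^ 2) ^ 2 ≤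
      8 * r ^ 8 + 8 * r ^ 2 * (fun z : Fin d → ℝ => (d : ℝ) * ∑ i, z i ^ 4) (B *ᵥ (x - μ)) := by
    intro x
    have a1 : ∑ i, x i ^ 2 ≤ 2 * ∑ i, μ i ^ 2 + 2 * ∑ i, (x - μ) i ^ 2 := by
      rw [Finset.mul_sum, Finset.mul_sum, ← Finset.sum_add_distrib]
      refine Finset.sum_le_sum fun i _ => ?_
      simp only [Pi.sub_apply]
      nlinarith [sq_nonneg (x i - 2 * μ i)]
    have a2 := s17_inv B hB hTinv (x - μ)
    have a3 : (∑ i, (B *ᵥ (x - μ)) i ^ 2) ^ 2 ≤ (d : ℝ) * ∑ i, (B *ᵥ (x - μ)) i ^ 4 := by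
      have := sq_sum_le_card_mul_sum_sq (s := Finset.univ) (f := fun i => (B *ᵥ (x - μ)) i ^ 2)
      simpa [← pow_mul] using this
    set u := ∑ i, (B *ᵥ (x - μ)) i ^ 2
    have hx0 : 0 ≤ ∑ i, x i ^ 2 := Finset.sum_nonneg fun i _ => sq_nonneg _
    calc (∑ i, x i ^ 2) ^ 2 ≤ (2 * r ^ 4 + 2 * (r * u)) ^ 2 := by
          gcongr
          linarith
      _ ≤ 8 * r ^ 8 + 8 * r ^ 2 * u ^ 2 := by nlinarith [sq_nonneg (r ^ 4 - r * u)]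
      _ ≤ _ := by
          simp only
          gcongr
  have hgi : Integrable (fun x => (fun z : Fin d → ℝ => (d : ℝ) * ∑ i, z i ^ 4)
      (B *ᵥ (x - μ))) G := by
    have := s17_pi_m4_int d
    rw [← hmap] at this
    exact this.comp_measurable hm
  have hgv : ∫ x, (fun z : Fin d → ℝ => (d : ℝ) * ∑ i, z i ^ 4) (B *ᵥ (x - μ)) ∂G =
      3 * d ^ 2 := by
    rw [← s17_pi_m4 d, ← hmap, integral_map hm.aemeasurable]
    exact (Continuous.measurable (by fun_prop)).aestronglyMeasurable
  have hbi := (integrable_const (μ := G) (8 * r ^ 8)).add (hgi.const_mul (8 * r ^ 2))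
  have hfi : Integrable (fun x : Fin d → ℝ => (∑ i, x i ^ 2) ^ 2) G := by
    refine hbi.mono' (Continuous.measurable (by fun_prop)).aestronglyMeasurable (ae_of_all _ fun x => ?_)
    rw [Real.norm_eq_abs, abs_of_nonneg (sq_nonneg _)]
    exact hpt x
  have hfv : ∫ x, (∑ i, x i ^ 2) ^ 2 ∂G ≤ 8 * r ^ 8 + 24 * d ^ 2 * r ^ 2 := by
    refine (integral_mono hfi hbi hpt).trans (le_of_eq ?_)
    simp only [Pi.add_apply]
    rw [integral_add (integrable_const _) (hgi.const_mul _), integral_const_mul (8 * r ^ 2), hgv]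
    simp
    ring
  refine ⟨cond_isProbabilityMeasure hS0, ?_, ?_⟩
  · unfold truncGauss ProbabilityTheory.cond
    exact hfi.restrict.smul_measure (ENNReal.inv_ne_top.mpr hS0)
  · unfold truncGauss ProbabilityTheory.cond
    rw [integral_smul_measure, smul_eq_mul, ENNReal.toReal_inv, div_eq_inv_mul]
    have h0 : ∫ x in S, (∑ i, x i ^ 2) ^ 2 ∂G ≤ ∫ x, (∑ i, x i ^ 2) ^ 2 ∂G :=
      setIntegral_le_integral hfi (ae_of_all _ fun x => sq_nonneg _)
    refine mul_le_mul (inv_anti₀ hβ0 hβS) (h0.trans hfv)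
      (integral_nonneg fun x => sq_nonneg _) (by positivity)

lemma s17_tDist {d : ℕ} (x y : Fin d → ℝ) :
    tDistSq x y ≤ 5 / 4 * (∑ i, x i ^ 2) ^ 2 + 5 / 4 * (∑ i, y i ^ 2) ^ 2 + 2 := by
  have e1 : ∀ z : Fin d → ℝ, (∑ i, z i ^ 2) ^ 2 = ∑ i, ∑ j, (z i * z j) ^ 2 := by
    intro z
    rw [sq, Finset.sum_mul_sum]
    simp [mul_pow]
  have e2 : (∑ i, x i * y i) ^ 2 = ∑ i, ∑ j, (x i * x j) * (y i * y j) := by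
    rw [sq, Finset.sum_mul_sum]
    refine Finset.sum_congr rfl fun i _ => Finset.sum_congr rfl fun j _ => by ring
  have h1 : fnorm ((-(1 / 2) : ℝ) • vecMulVec x x - (-(1 / 2) : ℝ) • vecMulVec y y) ^ 2 =
      1 / 4 * ((∑ i, x i ^ 2) ^ 2 + (∑ i, y i ^ 2) ^ 2) - 1 / 2 * (∑ i, x i * y i) ^ 2 := by
    rw [fnorm, Real.sq_sqrt (by positivity), e1, e1, e2]
    simp only [← Finset.sum_add_distrib, Finset.mul_sum, ← Finset.sum_sub_distrib]
    refine Finset.sum_congr rfl fun i _ => Finset.sum_congr rfl fun j _ => ?_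
    simp [vecMulVec_apply]
    ring
  have h2 : vnorm (x - y) ^ 2 ≤ 2 * ∑ i, x i ^ 2 + 2 * ∑ i, y i ^ 2 := by
    rw [vnorm, Real.sq_sqrt (by positivity)]
    simp only [← Finset.sum_add_distrib, Finset.mul_sum]
    refine Finset.sum_le_sum fun i _ => ?_
    simp only [Pi.sub_apply]
    nlinarith [sq_nonneg (x i + y i)]
  unfold tDistSq
  rw [h1]
  nlinarith [sq_nonneg (∑ i, x i * y i), sq_nonneg (∑ i, x i ^ 2 - 1),
    sq_nonneg (∑ i, y i ^ 2 - 1)]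

/-- Let `r ≥ 1`, `β ∈ (0,1]`, and let `(ν,T)` and `(ν*,T*)` be parameter
pairs with `T, T*` symmetric positive definite, both lying in the domain
`{‖ν‖₂ ≤ r, ‖I − T‖_F ≤ r, ‖T⁻¹‖₂ ≤ r}`.  With `μ = T⁻¹ν`, `Σ = T⁻¹`, `μ* = T*⁻¹ν*`,
`Σ* = T*⁻¹`, if the measurable set `S` satisfies `N(μ,Σ;S) ≥ β` and `N(μ*,Σ*;S) ≥ β`, then
`E_{x ∼ N(μ*,Σ*,S)} E_{y ∼ N(μ,Σ,S)} ‖t(x) − t(y)‖₂² ≤ 100 d² r⁸ / β`. -/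
theorem statement17 {d : ℕ} (r β : ℝ) (hr : 1 ≤ r) (hβ0 : 0 < β) (hβ1 : β ≤ 1)
    (ν νstar : Fin d → ℝ) (T Tstar : Matrix (Fin d) (Fin d) ℝ)
    (hT : T.PosDef) (hTs : T.IsSymm) (hTstar : Tstar.PosDef) (hTstars : Tstar.IsSymm)
    (hν : vnorm ν ≤ r) (hTnorm : fnorm (1 - T) ≤ r) (hTinv : specNorm T⁻¹ ≤ r)
    (hνstar : vnorm νstar ≤ r) (hTstarnorm : fnorm (1 - Tstar) ≤ r)
    (hTstarinv : specNorm Tstar⁻¹ ≤ r)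
    (S : Set (Fin d → ℝ)) (hS : MeasurableSet S)
    (hmass : ENNReal.ofReal β ≤ gauss (T⁻¹ *ᵥ ν) T⁻¹ S)
    (hmassstar : ENNReal.ofReal β ≤ gauss (Tstar⁻¹ *ᵥ νstar) Tstar⁻¹ S) :
    ∫ x, ∫ y, tDistSq x y
        ∂(truncGauss (T⁻¹ *ᵥ ν) T⁻¹ S) ∂(truncGauss (Tstar⁻¹ *ᵥ νstar) Tstar⁻¹ S) ≤
      100 * (d : ℝ) ^ 2 * r ^ 8 / β := by
  rcases Nat.eq_zero_or_pos d with rfl | hd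
  · simp [tDistSq, fnorm, vnorm]
  obtain ⟨P1, I1, V1⟩ := s17_trunc r β hr hβ0 ν T hT hν hTinv S hmass
  obtain ⟨P2, I2, V2⟩ := s17_trunc r β hr hβ0 νstar Tstar hTstar hνstar hTstarinv S hmassstar
  set Q := truncGauss (T⁻¹ *ᵥ ν) T⁻¹ S
  set P := truncGauss (Tstar⁻¹ *ᵥ νstar) Tstar⁻¹ S
  have t0 : ∀ x y : Fin d → ℝ, 0 ≤ tDistSq x y := fun x y => by unfold tDistSq; positivity
  set M := (8 * r ^ 8 + 24 * (d : ℝ) ^ 2 * r ^ 2) / β with hM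
  have inner : ∀ x : Fin d → ℝ, ∫ y, tDistSq x y ∂Q ≤
      5 / 4 * (∑ i, x i ^ 2) ^ 2 + (5 / 4 * M + 2) := by
    intro x
    have hi : Integrable (fun y : Fin d → ℝ =>
        (5 / 4 * (∑ i, x i ^ 2) ^ 2 + 2) + 5 / 4 * (∑ i, y i ^ 2) ^ 2) Q :=
      (integrable_const _).add (I1.const_mul _)
    refine (integral_mono_of_nonneg (ae_of_all _ (t0 x)) hi
      (ae_of_all _ fun y => ?_)).trans ?_
    · have := s17_tDist x y
      simp only
      linarith
    · rw [integral_add (integrable_const _) (I1.const_mul _), integral_const_mul]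
      simp
      linarith
  have hi : Integrable (fun x : Fin d → ℝ =>
      5 / 4 * (∑ i, x i ^ 2) ^ 2 + (5 / 4 * M + 2)) P :=
    (I2.const_mul _).add (integrable_const _)
  refine (integral_mono_of_nonneg (ae_of_all _ fun x => integral_nonneg (t0 x)) hi
    (ae_of_all _ inner)).trans ?_
  rw [integral_add (I2.const_mul _) (integrable_const _), integral_const_mul]
  simp only [integral_const, probReal_univ, one_smul]
  have hd1 : (1 : ℝ) ≤ (d : ℝ) ^ 2 := by
    have : (1 : ℝ) ≤ d := by exact_mod_cast hd
    nlinarith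
  have hr2 : r ^ 2 ≤ r ^ 8 := pow_le_pow_right₀ hr (by norm_num)
  have hr8 : 1 ≤ r ^ 8 := one_le_pow₀ hr
  have k1 : r ^ 8 ≤ (d : ℝ) ^ 2 * r ^ 8 := by nlinarith
  have k2 : (d : ℝ) ^ 2 * r ^ 2 ≤ (d : ℝ) ^ 2 * r ^ 8 := by gcongr
  have hMb : M ≤ 32 * ((d : ℝ) ^ 2 * r ^ 8) / β := by
    rw [hM]
    gcongr
    linarith
  have h2 : (2 : ℝ) ≤ 2 * ((d : ℝ) ^ 2 * r ^ 8) / β := by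
    rw [le_div_iff₀ hβ0]
    nlinarith
  have e : 100 * (d : ℝ) ^ 2 * r ^ 8 / β = 100 * (((d : ℝ) ^ 2 * r ^ 8) / β) := by ring
  have e2 : 32 * ((d : ℝ) ^ 2 * r ^ 8) / β = 32 * (((d : ℝ) ^ 2 * r ^ 8) / β) := by ring
  have e3 : 2 * ((d : ℝ) ^ 2 * r ^ 8) / β = 2 * (((d : ℝ) ^ 2 * r ^ 8) / β) := by ring
  rw [e]
  rw [e2] at hMb
  rw [e3] at h2
  have : 0 ≤ ((d : ℝ) ^ 2 * r ^ 8) / β := by positivity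
  linarith

end
end
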